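/- Let K_xy ⊂ ℝ^{n+m} and K_yz ⊂ ℝ^{m+p} be compact, assume K is nonempty and has nonempty interior, and let f ∈ ℝ[X,Y] + ℝ[Y,Z]. Let f* = min{f(x,y,z) : (x,y,z) ∈ K} be the minimum of f on K. Then sup{λ ∈ ℝ : f − λ ∈ P(g) + P(h)} = f*. In particular, for every ε > 0 there exist σ ∈ P(g) and ψ ∈ P(h) with f − f* + ε = σ + ψ, while for every λ with f − λ ∈ P(g) + P(h) one has λ ≤ f*. -/

import Mathlib

/-- A polynomial is a sum of squares. -/
def IsSOS {ι : Type*} (q : MvPolynomial ι ℝ) : Prop :=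
  ∃ (k : ℕ) (s : Fin k → MvPolynomial ι ℝ), q = ∑ i, (s i) ^ 2

/-- Membership in the preordering generated by a finite family `g`:
`σ = Σ_{J ⊆ I} σ_J ∏_{j ∈ J} g_j` with each `σ_J` a sum of squares. -/
def InPreordering {ι κ : Type*} [Fintype κ] [DecidableEq κ]
    (g : κ → MvPolynomial ι ℝ) (σ : MvPolynomial ι ℝ) : Prop :=
  ∃ c : Finset κ → MvPolynomial ι ℝ,
    (∀ J, IsSOS (c J)) ∧ σ = ∑ J : Finset κ, c J * ∏ j ∈ J, g j

namespace SparseSchm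
open Polynomial

/-- Polynomial intermediate value property. -/
def PIVT (R : Type*) [Field R] [LinearOrder R] : Prop :=
  ∀ (p : R[X]) (a b : R), a ≤ b → p.eval a ≤ 0 → 0 ≤ p.eval b → ∃ c, a ≤ c ∧ c ≤ b ∧ p.eval c = 0

/-- integer valued sign -/
noncomputable def sg {R : Type*} [Zero R] [LinearOrder R] (x : R) : ℤ := (SignType.sign x : ℤ)

section
variable {R : Type*} [Field R] [LinearOrder R] [IsStrictOrderedRing R]

lemma sg_mul (x y : R) : sg (x * y) = sg x * sg y := by
  simp [sg, sign_mul]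

lemma sg_pos {x : R} (h : 0 < x) : sg x = 1 := by simp [sg, sign_pos h]
lemma sg_neg {x : R} (h : x < 0) : sg x = -1 := by simp [sg, sign_neg h]
lemma sg_zero : sg (0 : R) = 0 := by simp [sg]

lemma sg_pow (x : R) (k : ℕ) : sg (x ^ k) = sg x ^ k := by
  simp [sg, sign_pow]

lemma sg_mul_self {x : R} (h : x ≠ 0) : sg x * sg x = 1 := by
  rcases lt_or_gt_of_ne h with h | h
  · simp [sg_neg h]
  · simp [sg_pos h]

lemma sg_eq_of_no_root (hR : PIVT R) (p : R[X]) {a b : R} (hab : a ≤ b)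
    (h : ∀ c, a ≤ c → c ≤ b → p.eval c ≠ 0) : sg (p.eval a) = sg (p.eval b) := by
  have ha := h a le_rfl hab
  have hb := h b hab le_rfl
  rcases lt_or_gt_of_ne ha with ha | ha <;> rcases lt_or_gt_of_ne hb with hb | hb
  · rw [sg_neg ha, sg_neg hb]
  · obtain ⟨c, h1, h2, h3⟩ := hR p a b hab ha.le hb.le
    exact absurd h3 (h c h1 h2)
  · obtain ⟨c, h1, h2, h3⟩ := hR (-p) a b hab (by simpa using ha.le) (by simpa using hb.le)
    exact absurd (by simpa using h3) (h c h1 h2)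
  · rw [sg_pos ha, sg_pos hb]

/-- The jump of the sign of `p` at `x`. -/
noncomputable def jump (p : R[X]) (x : R) : ℤ :=
  (1 - (-1) ^ (p.rootMultiplicity x)) *
    sg (eval x (p /ₘ (X - C x) ^ (p.rootMultiplicity x)))

lemma exists_factor (p : R[X]) (hp : p ≠ 0) (x : R) :
    ∃ k u, p = (X - C x) ^ k * u ∧ u.eval x ≠ 0 := by
  refine ⟨p.rootMultiplicity x, p /ₘ (X - C x) ^ (p.rootMultiplicity x), ?_, ?_⟩
  · exact (pow_mul_divByMonic_rootMultiplicity_eq p x).symm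
  · exact eval_divByMonic_pow_rootMultiplicity_ne_zero x hp

lemma jump_eq (k : ℕ) (u : R[X]) (x : R) (hu : u.eval x ≠ 0) :
    jump ((X - C x) ^ k * u) x = (1 - (-1) ^ k) * sg (u.eval x) := by
  have hu0 : u ≠ 0 := by rintro rfl; simp at hu
  have hne : (X - C x) ^ k * u ≠ 0 := mul_ne_zero (pow_ne_zero _ (X_sub_C_ne_zero x)) hu0
  have h1 : rootMultiplicity x ((X - C x) ^ k * u) = k := by
    rw [rootMultiplicity_mul hne, rootMultiplicity_X_sub_C_pow,
      rootMultiplicity_eq_zero (by simpa [IsRoot] using hu), add_zero]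
  unfold jump
  rw [h1]
  congr 3
  exact mul_divByMonic_cancel_left _ ((monic_X_sub_C x).pow k)

lemma jump_mul (f g : R[X]) (hf : f ≠ 0) (x : R) (hg : g.eval x ≠ 0) :
    jump (f * g) x = sg (g.eval x) * jump f x := by
  obtain ⟨k, u, rfl, hu⟩ := exists_factor f hf x
  rw [mul_assoc, jump_eq k _ x (by simpa using ⟨hu, hg⟩), jump_eq k u x hu, eval_mul, sg_mul]
  ring

lemma interval_sum (hR : PIVT R) (p : R[X]) (hp : p ≠ 0) : ∀ (N : ℕ) (a b : R), a < b →
    p.eval a ≠ 0 → p.eval b ≠ 0 → (p.roots.toFinset.filter (fun x => a < x ∧ x < b)).card = N →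
    ∑ x ∈ p.roots.toFinset.filter (fun x => a < x ∧ x < b), jump p x
      = sg (p.eval b) - sg (p.eval a) := by
  classical
  intro N
  induction N using Nat.strong_induction_on with
  | _ N ih =>
  intro a b hab ha hb hN
  have hmem : ∀ x, x ∈ p.roots.toFinset.filter (fun x => a < x ∧ x < b) ↔
      p.eval x = 0 ∧ a < x ∧ x < b := by
    intro x; simp [hp]
  by_cases h0 : N = 0
  · subst h0
    rw [Finset.card_eq_zero] at hN
    rw [hN, Finset.sum_empty, sg_eq_of_no_root hR p hab.le, sub_self]
    intro c hac hcb hc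
    have : c ∈ p.roots.toFinset.filter (fun x => a < x ∧ x < b) := by
      rw [hmem]
      refine ⟨hc, lt_of_le_of_ne hac ?_, lt_of_le_of_ne hcb ?_⟩
      · rintro rfl; exact ha hc
      · rintro rfl; exact hb hc
    rw [hN] at this
    simp at this
  by_cases h1 : N = 1
  · subst h1
    obtain ⟨x, hx⟩ := Finset.card_eq_one.mp hN
    rw [hx, Finset.sum_singleton]
    have hx' := (hmem x).1 (by rw [hx]; simp)
    obtain ⟨-, hax, hxb⟩ := hx'
    obtain ⟨k, u, hpu, hu⟩ := exists_factor p hp x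
    have hnr : ∀ c, a ≤ c → c ≤ b → u.eval c ≠ 0 := by
      intro c hac hcb hc
      have hpc : p.eval c = 0 := by rw [hpu]; simp [hc]
      have : c ∈ p.roots.toFinset.filter (fun x => a < x ∧ x < b) := by
        rw [hmem]
        refine ⟨hpc, lt_of_le_of_ne hac ?_, lt_of_le_of_ne hcb ?_⟩
        · rintro rfl; exact ha hpc
        · rintro rfl; exact hb hpc
      rw [hx, Finset.mem_singleton] at this
      subst this
      exact hu hc
    have e1 := sg_eq_of_no_root hR u hax.le (fun c h1 h2 => hnr c h1 (h2.trans hxb.le))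
    have e2 := sg_eq_of_no_root hR u hxb.le (fun c h1 h2 => hnr c (hax.le.trans h1) h2)
    rw [hpu, jump_eq k u x hu]
    simp only [eval_mul, eval_pow, eval_sub, eval_X, eval_C, sg_mul, sg_pow]
    rw [sg_pos (sub_pos.2 hxb), sg_neg (sub_neg.2 hax), e1, ← e2]
    ring
  · have h2 : 1 < (p.roots.toFinset.filter (fun x => a < x ∧ x < b)).card := by omega
    obtain ⟨x, hx, y, hy, hxy⟩ := Finset.one_lt_card.mp h2
    wlog hlt : x < y generalizing x y
    · exact this y hy x hx hxy.symm (lt_of_le_of_ne (not_lt.1 hlt) hxy.symm)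
    -- a nonroot between
    have hinf : (Set.Ioo x y).Infinite := Set.Ioo_infinite hlt
    obtain ⟨c, hc, hcr⟩ := hinf.exists_notMem_finset p.roots.toFinset
    have hpc : p.eval c ≠ 0 := by simpa [hp] using hcr
    rw [hmem] at hx hy
    have hac : a < c := hx.2.1.trans hc.1
    have hcb : c < b := hc.2.trans hy.2.2
    have hsplit : p.roots.toFinset.filter (fun x => a < x ∧ x < b) =
        (p.roots.toFinset.filter (fun x => a < x ∧ x < c)) ∪
        (p.roots.toFinset.filter (fun x => c < x ∧ x < b)) := by
      ext z
      simp only [Finset.mem_union, Finset.mem_filter, Multiset.mem_toFinset, mem_roots hp,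
        IsRoot.def]
      constructor
      · rintro ⟨hz, h1, h2⟩
        rcases lt_trichotomy z c with h | h | h
        · exact Or.inl ⟨hz, h1, h⟩
        · subst h; exact absurd hz hpc
        · exact Or.inr ⟨hz, h, h2⟩
      · rintro (⟨hz, h1, h2⟩ | ⟨hz, h1, h2⟩)
        · exact ⟨hz, h1, h2.trans hcb⟩
        · exact ⟨hz, hac.trans h1, h2⟩
    have hdisj : Disjoint (p.roots.toFinset.filter (fun x => a < x ∧ x < c))
        (p.roots.toFinset.filter (fun x => c < x ∧ x < b)) := by
      rw [Finset.disjoint_left]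
      intro z hz hz'
      simp only [Finset.mem_filter] at hz hz'
      exact lt_asymm hz.2.2 hz'.2.1
    have hc1 : 0 < (p.roots.toFinset.filter (fun x => a < x ∧ x < c)).card :=
      Finset.card_pos.2 ⟨x, by simp [hp, hx.1, hx.2.1, hc.1]⟩
    have hc2 : 0 < (p.roots.toFinset.filter (fun x => c < x ∧ x < b)).card :=
      Finset.card_pos.2 ⟨y, by simp [hp, hy.1, hy.2.2, hc.2]⟩
    have hcard := Finset.card_union_of_disjoint hdisj
    rw [← hsplit, hN] at hcard
    rw [hsplit, Finset.sum_union hdisj, ih _ (by omega) a c hac ha hpc rfl,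
      ih _ (by omega) c b hcb hpc hb rfl]
    ring

lemma eventually_ge (n : ℕ) : ∀ p : R[X], p.natDegree = n → 0 < p.leadingCoeff →
    ∃ δ > 0, ∃ M, ∀ y, M ≤ y → δ ≤ p.eval y := by
  induction n with
  | zero =>
    intro p hp hl
    rw [natDegree_eq_zero] at hp
    obtain ⟨c, rfl⟩ := hp
    refine ⟨c, by simpa using hl, 0, fun y _ => by simp⟩
  | succ n ih =>
    intro p hp hl
    have hq : p.divX.natDegree = n := by rw [natDegree_divX_eq_natDegree_tsub_one, hp]; rfl
    have hlq : p.divX.leadingCoeff = p.leadingCoeff := by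
      rw [leadingCoeff, leadingCoeff, hq, hp, coeff_divX]
    obtain ⟨δ, hδ, M, hM⟩ := ih p.divX hq (by rw [hlq]; exact hl)
    refine ⟨δ, hδ, max (max M 0) ((δ + |p.coeff 0|) / δ), fun y hy => ?_⟩
    have h1 : M ≤ y := (le_max_left _ _).trans ((le_max_left _ _).trans hy)
    have h2 : 0 ≤ y := (le_max_right _ _).trans ((le_max_left _ _).trans hy)
    have h3 : (δ + |p.coeff 0|) / δ ≤ y := (le_max_right _ _).trans hy
    rw [div_le_iff₀ hδ] at h3
    have h4 := hM y h1
    have h5 : p.eval y = p.divX.eval y * y + p.coeff 0 := by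
      conv_lhs => rw [← divX_mul_X_add p]
      simp
    have h6 := neg_abs_le (p.coeff 0)
    have h7 : δ * y ≤ p.divX.eval y * y := mul_le_mul_of_nonneg_right h4 h2
    rw [h5]
    linarith

lemma eventually_sg (p : R[X]) (hp : p ≠ 0) :
    ∃ M, ∀ y, M ≤ y → sg (p.eval y) = sg p.leadingCoeff := by
  have hl : p.leadingCoeff ≠ 0 := leadingCoeff_ne_zero.2 hp
  rcases lt_or_gt_of_ne hl with h | h
  · obtain ⟨δ, hδ, M, hM⟩ := eventually_ge _ (-p) rfl (by simpa using h)
    refine ⟨M, fun y hy => ?_⟩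
    have := hM y hy
    rw [eval_neg] at this
    rw [sg_neg h, sg_neg (by linarith)]
  · obtain ⟨δ, hδ, M, hM⟩ := eventually_ge _ p rfl h
    refine ⟨M, fun y hy => ?_⟩
    have := hM y hy
    rw [sg_pos h, sg_pos (by linarith)]

lemma eventually_sg' (p : R[X]) (hp : p ≠ 0) :
    ∃ M, ∀ y, y ≤ M → sg (p.eval y) = (-1) ^ p.natDegree * sg p.leadingCoeff := by
  have hne : p.comp (-X) ≠ 0 := by
    intro h
    apply hp
    have := congrArg (fun q => q.comp (-X)) h
    simpa [comp_assoc] using this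
  obtain ⟨M, hM⟩ := eventually_sg _ hne
  refine ⟨-M, fun y hy => ?_⟩
  have := hM (-y) (by linarith)
  simp only [eval_comp, eval_neg, eval_X, neg_neg] at this
  rw [this, leadingCoeff_comp (by simp), sg_mul, sg_pow]
  simp only [leadingCoeff_neg, leadingCoeff_X]
  rw [sg_neg (by simp : (-1 : R) < 0), mul_comm]

lemma total_sum (hR : PIVT R) (p : R[X]) (hp : p ≠ 0) :
    ∑ x ∈ p.roots.toFinset, jump p x = (1 - (-1) ^ p.natDegree) * sg p.leadingCoeff := by
  classical
  obtain ⟨M, hM⟩ := eventually_sg p hp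
  obtain ⟨M', hM'⟩ := eventually_sg' p hp
  have hl : sg p.leadingCoeff ≠ 0 := by
    intro h
    have := sg_mul_self (leadingCoeff_ne_zero.2 hp)
    rw [h] at this; simp at this
  have hb : ∀ y, M ≤ y → p.eval y ≠ 0 := by
    intro y hy h
    have := hM y hy
    rw [h, sg_zero] at this
    exact hl this.symm
  have ha : ∀ y, y ≤ M' → p.eval y ≠ 0 := by
    intro y hy h
    have := hM' y hy
    rw [h, sg_zero] at this
    have h2 : ((-1 : ℤ)) ^ p.natDegree ≠ 0 := by positivity
    exact mul_ne_zero h2 hl this.symm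
  set a := min M' (M - 1) with haa
  have hab : a < M := lt_of_le_of_lt (min_le_right _ _) (by linarith)
  have key := interval_sum hR p hp _ a M hab (ha a (min_le_left _ _)) (hb M le_rfl) rfl
  have : p.roots.toFinset.filter (fun x => a < x ∧ x < M) = p.roots.toFinset := by
    apply Finset.filter_true_of_mem
    intro x hx
    have hx0 : p.eval x = 0 := by simpa [hp] using hx
    constructor
    · by_contra h
      exact ha x ((not_lt.1 h).trans (min_le_left _ _)) hx0
    · by_contra h
      exact hb x (not_lt.1 h) hx0
  rw [this, hM M le_rfl, hM' a (min_le_left _ _)] at key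
  rw [key]; ring

/-- Cauchy index -/
noncomputable def J (f g : R[X]) : ℤ := ∑ x ∈ f.roots.toFinset, sg (g.eval x) * jump f x

lemma J_recip (hR : PIVT R) (f g : R[X]) (hf : f ≠ 0) (hg : g ≠ 0) (h : IsCoprime f g) :
    J f g + J g f = (1 - (-1) ^ (f.natDegree + g.natDegree)) *
      (sg f.leadingCoeff * sg g.leadingCoeff) := by
  classical
  have ht := total_sum hR (f * g) (mul_ne_zero hf hg)
  rw [natDegree_mul hf hg, leadingCoeff_mul, sg_mul] at ht
  rw [← ht, roots_mul (mul_ne_zero hf hg), Multiset.toFinset_add]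
  have hco : ∀ x, f.eval x = 0 → g.eval x ≠ 0 := by
    intro x hx hx'
    obtain ⟨u, v, huv⟩ := h
    have := congrArg (eval x) huv
    simp [hx, hx'] at this
  rw [Finset.sum_union]
  · unfold J
    congr 1
    · refine Finset.sum_congr rfl fun x hx => ?_
      have hx0 : f.eval x = 0 := by simpa [hf] using hx
      rw [jump_mul f g hf x (hco x hx0)]
    · refine Finset.sum_congr rfl fun x hx => ?_
      have hx0 : g.eval x = 0 := by simpa [hg] using hx
      rw [mul_comm f g, jump_mul g f hg x (fun h => hco x h hx0)]
  · rw [Finset.disjoint_left]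
    intro x hx hx'
    exact hco x (by simpa [hf] using hx) (by simpa [hg] using hx')

lemma J_congr (f g r : R[X]) (q : R[X]) (hf : f ≠ 0) (h : g = r + f * q) : J f g = J f r := by
  unfold J
  refine Finset.sum_congr rfl fun x hx => ?_
  have hx0 : f.eval x = 0 := by simpa [hf] using hx
  rw [h]; simp [hx0]

lemma J_derivative (f : R[X]) (hf : f ≠ 0) (hs : IsCoprime f (derivative f)) :
    J f (derivative f) = 2 * f.roots.toFinset.card := by
  unfold J
  rw [Finset.sum_congr rfl (g := fun _ => (2 : ℤ))]
  · simp [mul_comm]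
  intro x hx
  have hx0 : f.eval x = 0 := by simpa [hf] using hx
  have hd : (derivative f).eval x ≠ 0 := by
    intro hx'
    obtain ⟨u, v, huv⟩ := hs
    have := congrArg (eval x) huv
    simp [hx0, hx'] at this
  obtain ⟨u, rfl⟩ := dvd_iff_isRoot.2 hx0
  have hu : (derivative ((X - C x) * u)).eval x = u.eval x := by simp
  rw [hu] at hd
  have hj := jump_eq 1 u x hd
  rw [pow_one] at hj
  rw [hj, hu]
  have := sg_mul_self hd
  linear_combination 2 * this

end

section
variable {L R S : Type*} [Field L] [Field R] [LinearOrder R] [IsStrictOrderedRing R]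
  [Field S] [LinearOrder S] [IsStrictOrderedRing S]

lemma J_eq (hR : PIVT R) (hS : PIVT S) (i : L →+* R) (j : L →+* S)
    (hs : ∀ c, sg (i c) = sg (j c)) : ∀ (N : ℕ) (f g : L[X]), f.natDegree = N → f ≠ 0 →
    IsCoprime f g → J (f.map i) (g.map i) = J (f.map j) (g.map j) := by
  intro N
  induction N using Nat.strong_induction_on with
  | _ N ih =>
  intro f g hN hf hc
  have hgr : g = g % f + f * (g / f) := (EuclideanDomain.mod_add_div g f).symm
  set r := g % f with hr
  have hfi : f.map i ≠ 0 := (Polynomial.map_ne_zero_iff i.injective).2 hf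
  have hfj : f.map j ≠ 0 := (Polynomial.map_ne_zero_iff j.injective).2 hf
  rw [J_congr (f.map i) (g.map i) (r.map i) ((g / f).map i) hfi
      (by conv_lhs => rw [hgr]
          simp),
    J_congr (f.map j) (g.map j) (r.map j) ((g / f).map j) hfj
      (by conv_lhs => rw [hgr]
          simp)]
  by_cases hr0 : r = 0
  · rw [hr0] at hgr
    have hu : IsUnit f := by
      obtain ⟨u, v, huv⟩ := hc
      rw [hgr] at huv
      exact IsUnit.of_mul_eq_one (u + v * (g / f)) (by rw [← huv]; ring)
    obtain ⟨c, hc', rfl⟩ := Polynomial.isUnit_iff.1 hu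
    simp [J]
  · have hcr : IsCoprime f r := by
      rw [hgr] at hc
      exact (IsCoprime.add_mul_left_right_iff).1 hc
    have hri : r.map i ≠ 0 := (Polynomial.map_ne_zero_iff i.injective).2 hr0
    have hrj : r.map j ≠ 0 := (Polynomial.map_ne_zero_iff j.injective).2 hr0
    have h1 := J_recip hR (f.map i) (r.map i) hfi hri (hcr.map (mapRingHom i))
    have h2 := J_recip hS (f.map j) (r.map j) hfj hrj (hcr.map (mapRingHom j))
    have hdeg : r.natDegree < N := by
      rw [← hN]
      exact natDegree_lt_natDegree hr0 (EuclideanDomain.mod_lt g hf)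
    have h3 := ih _ hdeg r f rfl hr0 hcr.symm
    simp only [natDegree_map, leadingCoeff_map, hs] at h1 h2
    linarith

lemma root_transfer (hR : PIVT R) (hS : PIVT S) (i : L →+* R) (j : L →+* S)
    (hs : ∀ c, sg (i c) = sg (j c)) (f : L[X]) (hf : Irreducible f) (x : R)
    (hx : (f.map i).eval x = 0) : ∃ y : S, (f.map j).eval y = 0 := by
  haveI : CharZero L := by
    refine ⟨fun a b h => ?_⟩
    have := congrArg i h
    simpa using this
  have hsep : IsCoprime f (derivative f) := hf.separable
  have hf0 := hf.ne_zero
  have hfi : f.map i ≠ 0 := (Polynomial.map_ne_zero_iff i.injective).2 hf0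
  have hfj : f.map j ≠ 0 := (Polynomial.map_ne_zero_iff j.injective).2 hf0
  have h := J_eq hR hS i j hs _ f (derivative f) rfl hf0 hsep
  have hi : IsCoprime (f.map i) (derivative (f.map i)) := by
    rw [derivative_map]; exact hsep.map (mapRingHom i)
  have hj : IsCoprime (f.map j) (derivative (f.map j)) := by
    rw [derivative_map]; exact hsep.map (mapRingHom j)
  rw [← derivative_map, ← derivative_map, J_derivative _ hfi hi, J_derivative _ hfj hj] at h
  have hpos : 0 < (f.map i).roots.toFinset.card :=
    Finset.card_pos.2 ⟨x, by simpa [hfi] using hx⟩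
  have hpos' : 0 < (f.map j).roots.toFinset.card := by omega
  obtain ⟨y, hy⟩ := Finset.card_pos.1 hpos'
  exact ⟨y, by simpa [hfj] using hy⟩

lemma PIVT.exists_sq (hR : PIVT R) (x : R) (hx : 0 ≤ x) : ∃ y, y * y = x := by
  obtain ⟨c, -, -, h⟩ := hR (X ^ 2 - C x) 0 (x + 1) (by linarith) (by simpa using hx)
    (by simp; nlinarith)
  refine ⟨c, ?_⟩
  simp at h
  linarith [sq c]

/-- Embedding of an algebraic real closed extension. -/
lemma exists_hom [Algebra L R] [Algebra L S] [Algebra.IsAlgebraic L R]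
    (hR : PIVT R) (hS : PIVT S)
    (hs : ∀ c : L, sg (algebraMap L R c) = sg (algebraMap L S c)) :
    ∃ φ : R →ₐ[L] S, ∀ x, 0 ≤ x → 0 ≤ φ x := by
  have : Nonempty (R →ₐ[L] S) := by
    apply Field.nonempty_algHom_of_exists_root
    intro x
    have hintg : IsIntegral L x := Algebra.IsIntegral.isIntegral x
    obtain ⟨y, hy⟩ := root_transfer hR hS (algebraMap L R) (algebraMap L S) hs (minpoly L x)
      (minpoly.irreducible hintg) x (by rw [eval_map_algebraMap]; exact minpoly.aeval L x)
    exact ⟨y, by rw [← eval_map_algebraMap]; exact hy⟩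
  obtain ⟨φ⟩ := this
  refine ⟨φ, fun x hx => ?_⟩
  obtain ⟨y, rfl⟩ := hR.exists_sq x hx
  rw [map_mul]
  exact mul_self_nonneg _
end
end SparseSchm

namespace SparseSchm
open Polynomial

section
variable {R : Type*} [Field R] [LinearOrder R] [IsStrictOrderedRing R]

lemma germ_pivt {α : Type*} (U : Ultrafilter α) (hR : PIVT R) :
    PIVT (Filter.Germ (U : Filter α) R) := by
  intro p a b hab ha hb
  have hsurj : Function.Surjective (Filter.Germ.coeRingHom (R := R) (U : Filter α)) := by
    intro g
    induction g using Filter.Germ.inductionOn with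
    | _ f => exact ⟨f, rfl⟩
  obtain ⟨P, rfl⟩ := Polynomial.map_surjective (Filter.Germ.coeRingHom (U : Filter α)) hsurj p
  obtain ⟨a, rfl⟩ : ∃ f : α → R, (Filter.Germ.coeRingHom (U : Filter α)) f = a := hsurj a
  obtain ⟨b, rfl⟩ : ∃ f : α → R, (Filter.Germ.coeRingHom (U : Filter α)) f = b := hsurj b
  have hev : ∀ (c : α → R) (s : α),
      (P.eval c) s = (P.map (Pi.evalRingHom (fun _ => R) s)).eval (c s) := by
    intro c s
    have := Polynomial.hom_eval₂ P (RingHom.id _) (Pi.evalRingHom (fun _ : α => R) s) c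
    rw [eval_map]
    simpa [eval₂_id] using this
  rw [eval_map_apply] at ha hb
  have h1 : ∀ᶠ s in (U : Filter α), a s ≤ b s := Filter.Germ.coe_le.1 hab
  have h2 : ∀ᶠ s in (U : Filter α), (P.eval a) s ≤ 0 := Filter.Germ.coe_le.1 ha
  have h3 : ∀ᶠ s in (U : Filter α), 0 ≤ (P.eval b) s := Filter.Germ.coe_le.1 hb
  have h4 : ∀ s, ∃ c, (a s ≤ b s ∧ (P.eval a) s ≤ 0 ∧ 0 ≤ (P.eval b) s) →
      a s ≤ c ∧ c ≤ b s ∧ (P.map (Pi.evalRingHom (fun _ => R) s)).eval c = 0 := by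
    intro s
    by_cases h : (a s ≤ b s ∧ (P.eval a) s ≤ 0 ∧ 0 ≤ (P.eval b) s)
    · rw [hev, hev] at h
      obtain ⟨c, hc⟩ := hR _ _ _ h.1 h.2.1 h.2.2
      exact ⟨c, fun _ => hc⟩
    · exact ⟨0, fun h' => absurd h' h⟩
  choose c hc using h4
  refine ⟨Filter.Germ.coeRingHom (U : Filter α) c, ?_, ?_, ?_⟩
  · apply Filter.Germ.coe_le.2
    filter_upwards [h1, h2, h3] with s e1 e2 e3
    exact (hc s ⟨e1, e2, e3⟩).1
  · apply Filter.Germ.coe_le.2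
    filter_upwards [h1, h2, h3] with s e1 e2 e3
    exact (hc s ⟨e1, e2, e3⟩).2.1
  · rw [eval_map_apply]
    apply Filter.Germ.coe_eq.2
    filter_upwards [h1, h2, h3] with s e1 e2 e3
    rw [hev]
    exact (hc s ⟨e1, e2, e3⟩).2.2

/-- relatively algebraically closed subfields -/
def RAC (k : Subfield R) : Prop :=
  ∀ p : k[X], p ≠ 0 → ∀ x : R, (p.map k.subtype).eval x = 0 → x ∈ k

lemma RAC.pivt (hR : PIVT R) {k : Subfield R} (hk : RAC k) : PIVT k := by
  intro p a b hab ha hb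
  by_cases hp : p = 0
  · exact ⟨a, le_rfl, hab, by simp [hp]⟩
  have hev : ∀ c : k, (p.map k.subtype).eval (c : R) = ((p.eval c : k) : R) := by
    intro c
    exact eval_map_apply (f := k.subtype) (p := p) (x := c)
  obtain ⟨c, h1, h2, h3⟩ := hR (p.map k.subtype) a b hab (by rw [hev]; exact_mod_cast ha)
    (by rw [hev]; exact_mod_cast hb)
  refine ⟨⟨c, hk p hp c h3⟩, h1, h2, ?_⟩
  have := hev ⟨c, hk p hp c h3⟩
  rw [h3] at this
  exact_mod_cast this.symm

lemma algClosure_rac {L : Type*} [Field L] [Algebra L R] :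
    RAC (algebraicClosure L R).toSubfield := by
  intro p hp x hx
  have h1 : IsAlgebraic (algebraicClosure L R) x := ⟨p, hp, by rw [← eval_map_algebraMap]; exact hx⟩
  have h2 : IsAlgebraic L x := by
    exact IsAlgebraic.restrictScalars L h1
  exact mem_algebraicClosure_iff.2 h2

/-- Sign comparison across a cut. -/
lemma step (hR : PIVT R) (k : Subfield R) (hk : RAC k) (t : R) :
    ∃ k' : Subfield R, k ≤ k' ∧ t ∈ k' ∧ RAC k' ∧
      ∃ (U : Ultrafilter (Finset k)) (φ : k' →+* Filter.Germ (U : Filter (Finset k)) k),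
        (∀ x, 0 ≤ x → 0 ≤ φ x) ∧
        ∀ (c : k) (hc : (c : R) ∈ k'), φ ⟨c, hc⟩ = ((fun _ => c : Finset k → k) :
          Filter.Germ (U : Filter (Finset k)) k) := by
  classical
  by_cases ht : t ∈ k
  · refine ⟨k, le_rfl, ht, hk, pure ∅, (Filter.Germ.coeRingHom _).comp (Pi.constRingHom _ _),
      ?_, ?_⟩
    · intro x hx
      apply Filter.Germ.coe_le.2
      exact Filter.Eventually.of_forall fun _ => hx
    · intro c hc
      rfl
  -- the cut
  have hτ : ∀ F : Finset k, ∃ s : k, ∀ c ∈ F, ((c : R) < t → c < s) ∧ (t < (c : R) → s < c) := by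
    intro F
    obtain ⟨s, h1, h2⟩ := Order.exists_between_finsets (F.filter fun c : k => (c : R) < t)
      (F.filter fun c : k => t < (c : R)) (by
        intro x hx y hy
        simp only [Finset.mem_filter] at hx hy
        exact_mod_cast hx.2.trans hy.2)
    exact ⟨s, fun c hc => ⟨fun h => h1 c (by simp [hc, h]), fun h => h2 c (by simp [hc, h])⟩⟩
  choose τ hτ using hτ
  let U : Ultrafilter (Finset k) := Ultrafilter.of Filter.atTop
  have hU : (U : Filter (Finset k)) ≤ Filter.atTop := Ultrafilter.of_le _
  let K := Filter.Germ (U : Filter (Finset k)) k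
  let cst : k →+* K := (Filter.Germ.coeRingHom _).comp (Pi.constRingHom _ _)
  let i1 : k[X] →+* R := eval₂RingHom k.subtype t
  let i2 : k[X] →+* K := eval₂RingHom cst (Filter.Germ.coeRingHom (U : Filter (Finset k)) τ)
  have hi2 : ∀ p, i2 p = Filter.Germ.coeRingHom (U : Filter (Finset k)) (fun F => p.eval (τ F)) := by
    intro p
    have h1 := Polynomial.hom_eval₂ p (Pi.constRingHom (Finset k) k)
      (Filter.Germ.coeRingHom (U : Filter (Finset k))) τ
    change eval₂ cst _ p = _
    rw [← h1]
    congr 1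
    funext F
    have h2 := Polynomial.hom_eval₂ p (Pi.constRingHom (Finset k) k)
      (Pi.evalRingHom (fun _ : Finset k => k) F) τ
    exact h2
  have hev : ∀ (p : k[X]) (c : k), (p.map k.subtype).eval (c : R) = ((p.eval c : k) : R) := by
    intro p c
    exact eval_map_apply (f := k.subtype) (p := p) (x := c)
  have hi1 : ∀ p, i1 p = (p.map k.subtype).eval t := fun p => (eval_map _ _).symm
  have hi1ne : ∀ p, p ≠ 0 → i1 p ≠ 0 := by
    intro p hp h
    rw [hi1] at h
    exact ht (hk p hp t h)
  have hsgk : ∀ c : k, sg (c : R) = sg c := by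
    intro c
    rcases lt_trichotomy c 0 with h | h | h
    · rw [sg_neg h, sg_neg (by exact_mod_cast h)]
    · subst h; simp [sg]
    · rw [sg_pos h, sg_pos (by exact_mod_cast h)]
  have hsgp : ∀ p : k[X], p ≠ 0 → ∀ᶠ F in (U : Filter (Finset k)), sg (i1 p) = sg (p.eval (τ F)) := by
    intro p hp
    have h0 : ∀ᶠ F in (U : Filter (Finset k)), p.roots.toFinset ⊆ F :=
      hU (Filter.eventually_ge_atTop _)
    filter_upwards [h0] with F hF
    have hroot : ∀ c : R, (p.map k.subtype).eval c = 0 →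
        (c < t → c < τ F) ∧ (t < c → (τ F : R) < c) := by
      intro c hc
      have hck := hk p hp c hc
      have hc' : p.eval (⟨c, hck⟩ : k) = 0 := by
        have := hev p ⟨c, hck⟩
        rw [hc] at this
        exact_mod_cast this.symm
      have := hτ F ⟨c, hck⟩ (hF (by simpa [hp] using hc'))
      exact ⟨fun h => this.1 h, fun h => this.2 h⟩
    rw [← hsgk, ← hev, hi1]
    rcases le_total t (τ F) with h | h
    · apply sg_eq_of_no_root hR _ h
      intro c h1 h2 hc
      have hne : t ≠ c := by rintro rfl; exact ht (hk p hp _ hc)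
      exact absurd ((hroot c hc).2 (lt_of_le_of_ne h1 hne)) (not_lt.2 h2)
    · symm
      apply sg_eq_of_no_root hR _ h
      intro c h1 h2 hc
      have hne : c ≠ t := by rintro rfl; exact ht (hk p hp _ hc)
      exact absurd ((hroot c hc).1 (lt_of_le_of_ne h2 hne)) (not_lt.2 h1)
  have hsg12 : ∀ p, sg (i1 p) = sg (i2 p) := by
    intro p
    by_cases hp : p = 0
    · subst hp; simp [sg]
    have h := hsgp p hp
    rcases lt_or_gt_of_ne (hi1ne p hp) with h0 | h0
    · rw [sg_neg h0] at h ⊢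
      rw [sg_neg]
      rw [hi2]
      apply Filter.Germ.coe_lt.2
      filter_upwards [h] with F hF
      rcases lt_trichotomy (p.eval (τ F)) 0 with h1 | h1 | h1
      · exact h1
      · rw [h1, sg_zero] at hF; omega
      · rw [sg_pos h1] at hF; omega
    · rw [sg_pos h0] at h ⊢
      rw [sg_pos]
      rw [hi2]
      apply Filter.Germ.coe_lt.2
      filter_upwards [h] with F hF
      rcases lt_trichotomy (p.eval (τ F)) 0 with h1 | h1 | h1
      · rw [sg_neg h1] at hF; omega
      · rw [h1, sg_zero] at hF; omega
      · exact h1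
  have hi1inj : Function.Injective i1 :=
    (injective_iff_map_eq_zero i1).2 fun p hp => by_contra fun h => hi1ne p h hp
  have hi2inj : Function.Injective i2 := (injective_iff_map_eq_zero i2).2 fun p hp => by
    by_contra h
    have := hsg12 p
    rw [hp, sg_zero] at this
    have h2 := sg_mul_self (hi1ne p h)
    rw [this] at h2; simp at h2
  let L := FractionRing k[X]
  let j1 : L →+* R := IsFractionRing.lift hi1inj
  let j2 : L →+* K := IsFractionRing.lift hi2inj
  have hj1 : ∀ p, j1 (algebraMap k[X] L p) = i1 p := IsFractionRing.lift_algebraMap hi1inj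
  have hj2 : ∀ p, j2 (algebraMap k[X] L p) = i2 p := IsFractionRing.lift_algebraMap hi2inj
  have hsgj : ∀ c, sg (j1 c) = sg (j2 c) := by
    intro c
    obtain ⟨p, q, hq, rfl⟩ := IsFractionRing.div_surjective (A := k[X]) c
    have hq0 : q ≠ 0 := nonZeroDivisors.ne_zero hq
    have e1 : i1 q ≠ 0 := hi1ne q hq0
    have e2 : i2 q ≠ 0 := (map_ne_zero_iff i2 hi2inj).2 hq0
    rw [map_div₀, map_div₀, hj1, hj1, hj2, hj2]
    have f1 : sg (i1 p / i1 q) * sg (i1 q) = sg (i1 p) := by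
      rw [← sg_mul, div_mul_cancel₀ _ e1]
    have f2 : sg (i2 p / i2 q) * sg (i2 q) = sg (i2 p) := by
      rw [← sg_mul, div_mul_cancel₀ _ e2]
    have g1 := sg_mul_self e2
    rw [hsg12 p, hsg12 q, ← f2] at f1
    have hne : sg (i2 q) ≠ 0 := by intro h; rw [h] at g1; simp at g1
    exact mul_right_cancel₀ hne f1
  letI : Algebra L R := j1.toAlgebra
  letI : Algebra L K := j2.toAlgebra
  have hrac := algClosure_rac (L := L) (R := R)
  have hE : PIVT (algebraicClosure L R) := hrac.pivt hR
  have hKp : PIVT K := germ_pivt U (hk.pivt hR)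
  have hsgE : ∀ c : L, sg (algebraMap L (algebraicClosure L R) c) = sg (algebraMap L K c) := by
    intro c
    have h1 : sg (algebraMap L (algebraicClosure L R) c) = sg (j1 c) := by
      set d := algebraMap L (algebraicClosure L R) c with hd
      have hd' : (d : R) = j1 c := rfl
      rw [← hd']
      rcases lt_trichotomy d 0 with h | h | h
      · rw [sg_neg h, sg_neg (by exact_mod_cast h)]
      · rw [h]; simp [sg]
      · rw [sg_pos h, sg_pos (by exact_mod_cast h)]
    rw [h1, hsgj c]
    rfl
  obtain ⟨φ, hφ⟩ := exists_hom (L := L) (R := algebraicClosure L R) (S := K) hE hKp hsgE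
  have hCmem : ∀ c : k, (c : R) = algebraMap L R (algebraMap k[X] L (C c)) := by
    intro c
    change _ = j1 _
    rw [hj1, hi1]; simp
  refine ⟨(algebraicClosure L R).toSubfield, ?_, ?_, hrac, U, φ.toRingHom, hφ, ?_⟩
  · intro c hc
    have := hCmem ⟨c, hc⟩
    change c = _ at this
    rw [this]
    exact (algebraicClosure L R).algebraMap_mem _
  · have : t = algebraMap L R (algebraMap k[X] L X) := by
      change _ = j1 _
      rw [hj1, hi1]; simp
    rw [this]
    exact (algebraicClosure L R).algebraMap_mem _
  · intro c hc
    have h1 : (⟨c, hc⟩ : (algebraicClosure L R).toSubfield) =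
        algebraMap L (algebraicClosure L R) (algebraMap k[X] L (C c)) := by
      apply Subtype.ext
      exact hCmem c
    rw [h1]
    change φ _ = _
    rw [φ.commutes]
    change j2 _ = _
    rw [hj2, hi2]
    simp

end
end SparseSchm

namespace SparseSchm

section
variable {R : Type*} [Field R] [LinearOrder R] [IsStrictOrderedRing R]

lemma real_pivt : PIVT ℝ := by
  intro p a b hab ha hb
  have h := intermediate_value_Icc hab (p.continuous.continuousOn (s := Set.Icc a b))
  obtain ⟨c, hc, h0⟩ := h ⟨ha, hb⟩
  exact ⟨c, hc.1, hc.2, h0⟩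

/-- Solvability of the system in a subfield. -/
def Solv {σ ι : Type*} (φ : ℝ →+* R) (G : ι → MvPolynomial σ ℝ) (k : Subfield R) : Prop :=
  ∃ x : σ → R, (∀ i, x i ∈ k) ∧ ∀ g, 0 ≤ MvPolynomial.eval₂ φ x (G g)

lemma solv_base (hR : PIVT R) {σ ι : Type*} (φ : ℝ →+* R) (G : ι → MvPolynomial σ ℝ) :
    ∃ k : Subfield R, RAC k ∧ (∀ c, φ c ∈ k) ∧
      (Solv φ G k → ∃ x : σ → ℝ, ∀ g, 0 ≤ MvPolynomial.eval x (G g)) := by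
  let _ : Algebra ℝ R := φ.toAlgebra
  have hrac := algClosure_rac (L := ℝ) (R := R)
  have hE : PIVT (algebraicClosure ℝ R) := hrac.pivt hR
  refine ⟨(algebraicClosure ℝ R).toSubfield, hrac,
    fun c => (algebraicClosure ℝ R).algebraMap_mem c, ?_⟩
  have hsg : ∀ c : ℝ, sg (algebraMap ℝ (algebraicClosure ℝ R) c) = sg (algebraMap ℝ ℝ c) := by
    intro c
    have key : ∀ c : ℝ, 0 < c → 0 < algebraMap ℝ (algebraicClosure ℝ R) c := by
      intro c hc
      have h1 : c = Real.sqrt c * Real.sqrt c := (Real.mul_self_sqrt hc.le).symm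
      have h2 : algebraMap ℝ (algebraicClosure ℝ R) (Real.sqrt c) ≠ 0 := by
        rw [map_ne_zero]; exact (Real.sqrt_pos.2 hc).ne'
      rw [h1, map_mul]
      exact mul_self_pos.2 h2
    rcases lt_trichotomy c 0 with h | h | h
    · have := key (-c) (by linarith)
      rw [map_neg] at this
      rw [sg_neg (by linarith : algebraMap ℝ (algebraicClosure ℝ R) c < 0)]
      exact (sg_neg h).symm
    · subst h; simp [sg]
    · rw [sg_pos (key c h)]; exact (sg_pos h).symm
  obtain ⟨ψ, hψ⟩ := exists_hom (L := ℝ) (R := algebraicClosure ℝ R) (S := ℝ) hE real_pivt hsg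
  rintro ⟨x, hx, hG⟩
  refine ⟨fun i => ψ ⟨x i, hx i⟩, fun g => ?_⟩
  have h1 : MvPolynomial.eval (fun i => ψ ⟨x i, hx i⟩) (G g) =
      ψ (MvPolynomial.aeval (fun i => (⟨x i, hx i⟩ : algebraicClosure ℝ R)) (G g)) := by
    rw [← MvPolynomial.aeval_eq_eval]
    exact MvPolynomial.comp_aeval_apply (fun i => (⟨x i, hx i⟩ : algebraicClosure ℝ R)) ψ (G g) |>.symm
  rw [h1]
  apply hψ
  have h2 : ((MvPolynomial.aeval (fun i => (⟨x i, hx i⟩ : algebraicClosure ℝ R)) (G g) :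
      algebraicClosure ℝ R) : R) = MvPolynomial.eval₂ φ x (G g) :=
    MvPolynomial.comp_aeval_apply (fun i => (⟨x i, hx i⟩ : algebraicClosure ℝ R))
      (algebraicClosure ℝ R).val (G g)
  have h3 := hG g
  rw [← h2] at h3
  exact_mod_cast h3

lemma solv_step (hR : PIVT R) {σ ι : Type*} [Finite ι] (φ : ℝ →+* R) (G : ι → MvPolynomial σ ℝ)
    (k : Subfield R) (hk : RAC k) (hφ : ∀ c, φ c ∈ k) (t : R) :
    ∃ k' : Subfield R, k ≤ k' ∧ t ∈ k' ∧ RAC k' ∧ (Solv φ G k' → Solv φ G k) := by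
  obtain ⟨k', hle, htk, hrac, U, ψ, hψ, hc⟩ := step hR k hk t
  refine ⟨k', hle, htk, hrac, ?_⟩
  rintro ⟨x, hx, hG⟩
  let φ' : ℝ →+* k' := φ.codRestrict k' (fun c => hle (hφ c))
  let φk : ℝ →+* k := φ.codRestrict k hφ
  let x' : σ → k' := fun i => ⟨x i, hx i⟩
  have hsurj : Function.Surjective
      (Filter.Germ.coeRingHom (R := k) (U : Filter (Finset k))) := by
    intro g
    induction g using Filter.Germ.inductionOn with
    | _ f => exact ⟨f, rfl⟩
  have hY : ∀ i, ∃ y : Finset k → k,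
      Filter.Germ.coeRingHom (R := k) (U : Filter (Finset k)) y = ψ (x' i) := fun i => hsurj _
  choose Y hY using hY
  have hpos : ∀ g, 0 ≤ ψ (MvPolynomial.eval₂ φ' x' (G g)) := by
    intro g
    apply hψ
    have h2 : ((MvPolynomial.eval₂ φ' x' (G g) : k') : R) = MvPolynomial.eval₂ φ x (G g) :=
      MvPolynomial.eval₂_comp_left k'.subtype φ' x' (G g)
    have h3 := hG g
    rw [← h2] at h3
    exact_mod_cast h3
  have heq : ∀ g, ψ (MvPolynomial.eval₂ φ' x' (G g)) =
      Filter.Germ.coeRingHom (R := k) (U : Filter (Finset k))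
        (fun F => MvPolynomial.eval₂ φk (fun i => Y i F) (G g)) := by
    intro g
    rw [MvPolynomial.eval₂_comp_left]
    have h1 : (ψ.comp φ') = (Filter.Germ.coeRingHom (R := k) (U : Filter (Finset k))).comp
        ((Pi.constRingHom (Finset k) k).comp φk) := by
      ext c
      exact hc (φk c) (hle (hφ c))
    have h2 : (ψ ∘ x') = (Filter.Germ.coeRingHom (R := k) (U : Filter (Finset k))) ∘ Y := by
      funext i
      exact (hY i).symm
    rw [h1, h2, ← MvPolynomial.eval₂_comp_left]
    congr 1
    funext F
    exact MvPolynomial.eval₂_comp_left (Pi.evalRingHom (fun _ : Finset k => k) F) _ _ _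
  have hev : ∀ᶠ F in (U : Filter (Finset k)), ∀ g,
      0 ≤ MvPolynomial.eval₂ φk (fun i => Y i F) (G g) := by
    rw [Filter.eventually_all]
    intro g
    have := hpos g
    rw [heq] at this
    exact Filter.Germ.coe_le.1 this
  obtain ⟨F, hF⟩ := hev.exists
  refine ⟨fun i => Y i F, fun i => (Y i F).2, fun g => ?_⟩
  have h2 : ((MvPolynomial.eval₂ φk (fun i => Y i F) (G g) : k) : R) =
      MvPolynomial.eval₂ φ (fun i => (Y i F : R)) (G g) :=
    MvPolynomial.eval₂_comp_left k.subtype φk _ (G g)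
  rw [← h2]
  exact_mod_cast hF g

lemma solv_chain (hR : PIVT R) {σ ι : Type*} [Finite ι] (φ : ℝ →+* R) (G : ι → MvPolynomial σ ℝ)
    (s : Finset R) :
    ∃ k : Subfield R, RAC k ∧ (∀ c, φ c ∈ k) ∧ (∀ t ∈ s, t ∈ k) ∧
      (Solv φ G k → ∃ x : σ → ℝ, ∀ g, 0 ≤ MvPolynomial.eval x (G g)) := by
  classical
  induction s using Finset.induction_on with
  | empty =>
    obtain ⟨k, h1, h2, h3⟩ := solv_base hR φ G
    exact ⟨k, h1, h2, by simp, h3⟩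
  | insert t s _ ih =>
    obtain ⟨k, h1, h2, h3, h4⟩ := ih
    obtain ⟨k', e1, e2, e3, e4⟩ := solv_step hR φ G k h1 h2 t
    refine ⟨k', e3, fun c => e1 (h2 c), ?_, fun h => h4 (e4 h)⟩
    intro u hu
    rcases Finset.mem_insert.1 hu with rfl | hu
    · exact e2
    · exact e1 (h3 u hu)

/-- Artin-Lang transfer: a system solvable in a real closed extension of `ℝ` is solvable. -/
lemma transfer (hR : PIVT R) {σ ι : Type*} [Finite σ] [Finite ι] (φ : ℝ →+* R)
    (G : ι → MvPolynomial σ ℝ) (x : σ → R) (hx : ∀ g, 0 ≤ MvPolynomial.eval₂ φ x (G g)) :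
    ∃ x : σ → ℝ, ∀ g, 0 ≤ MvPolynomial.eval x (G g) := by
  classical
  obtain ⟨k, h1, h2, h3, h4⟩ := solv_chain hR φ G (Set.finite_range x).toFinset
  exact h4 ⟨x, fun i => h3 _ (by simp), hx⟩

end
end SparseSchm

namespace SparseSchm
open Polynomial

/-- Preorderings, possibly containing `-1`. -/
structure Pre {A : Type*} [CommRing A] (T : Set A) : Prop where
  add : ∀ x ∈ T, ∀ y ∈ T, x + y ∈ T
  mul : ∀ x ∈ T, ∀ y ∈ T, x * y ∈ T
  sq : ∀ x, x * x ∈ T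

section
variable {A : Type*} [CommRing A]

lemma Pre.zero {T : Set A} (h : Pre T) : (0 : A) ∈ T := by simpa using h.sq 0
lemma Pre.one {T : Set A} (h : Pre T) : (1 : A) ∈ T := by simpa using h.sq 1

lemma Pre.adjoin {T : Set A} (h : Pre T) (f : A) : Pre {z | ∃ a ∈ T, ∃ b ∈ T, z = a + f * b} where
  add := by
    rintro _ ⟨a, ha, b, hb, rfl⟩ _ ⟨c, hc, d, hd, rfl⟩
    exact ⟨a + c, h.add _ ha _ hc, b + d, h.add _ hb _ hd, by ring⟩
  mul := by
    rintro _ ⟨a, ha, b, hb, rfl⟩ _ ⟨c, hc, d, hd, rfl⟩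
    exact ⟨a * c + f * f * (b * d), h.add _ (h.mul _ ha _ hc) _
      (h.mul _ (h.sq f) _ (h.mul _ hb _ hd)), a * d + b * c,
      h.add _ (h.mul _ ha _ hd) _ (h.mul _ hb _ hc), by ring⟩
  sq := fun x => ⟨x * x, h.sq x, 0, h.zero, by ring⟩

/-- extension of a proper preordering to an ordering -/
lemma exists_ordering (T : Set A) (hT : Pre T) (h1 : (-1 : A) ∉ T) :
    ∃ Q : Set A, T ⊆ Q ∧ Pre Q ∧ (-1 : A) ∉ Q ∧ (∀ x, x ∈ Q ∨ -x ∈ Q) ∧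
      (∀ x y, x * y ∈ Q → -(x * y) ∈ Q → (x ∈ Q ∧ -x ∈ Q) ∨ (y ∈ Q ∧ -y ∈ Q)) := by
  obtain ⟨Q, hTQ, hQmax⟩ := zorn_subset_nonempty {Q : Set A | Pre Q ∧ (-1 : A) ∉ Q} (by
    intro c hc hchain hne
    refine ⟨⋃₀ c, ⟨⟨?_, ?_, ?_⟩, ?_⟩, fun s hs => Set.subset_sUnion_of_mem hs⟩
    · rintro x ⟨s, hs, hx⟩ y ⟨t, ht, hy⟩
      rcases hchain.total hs ht with h | h
      · exact ⟨t, ht, (hc ht).1.add _ (h hx) _ hy⟩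
      · exact ⟨s, hs, (hc hs).1.add _ hx _ (h hy)⟩
    · rintro x ⟨s, hs, hx⟩ y ⟨t, ht, hy⟩
      rcases hchain.total hs ht with h | h
      · exact ⟨t, ht, (hc ht).1.mul _ (h hx) _ hy⟩
      · exact ⟨s, hs, (hc hs).1.mul _ hx _ (h hy)⟩
    · intro x
      obtain ⟨s, hs⟩ := hne
      exact ⟨s, hs, (hc hs).1.sq x⟩
    · rintro ⟨s, hs, hx⟩
      exact (hc hs).2 hx) T ⟨hT, h1⟩
  have hQ : Pre Q := hQmax.prop.1
  have hQ1 : (-1 : A) ∉ Q := hQmax.prop.2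
  have key : ∀ x, x ∉ Q → ∃ a ∈ Q, ∃ b ∈ Q, -1 = a + x * b := by
    intro x hx
    by_contra hcon
    have hle : Q ⊆ {z | ∃ a ∈ Q, ∃ b ∈ Q, z = a + x * b} :=
      fun a ha => ⟨a, ha, 0, hQ.zero, by ring⟩
    have := hQmax.le_of_ge ⟨hQ.adjoin x, hcon⟩ hle
    exact hx (this ⟨0, hQ.zero, 1, hQ.one, by ring⟩)
  have hprod : ∀ x y, x ∉ Q → y ∉ Q → -(x * y) ∉ Q := by
    intro x y hx hy hxy
    obtain ⟨a, ha, b, hb, e1⟩ := key x hx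
    obtain ⟨c, hc, d, hd, e2⟩ := key y hy
    apply hQ1
    have : (-1 : A) = a + c + a * c + -(x * y) * (b * d) := by
      linear_combination (c + 1) * e1 - x * b * e2
    rw [this]
    exact hQ.add _ (hQ.add _ (hQ.add _ ha _ hc) _ (hQ.mul _ ha _ hc)) _
      (hQ.mul _ hxy _ (hQ.mul _ hb _ hd))
  refine ⟨Q, hTQ, hQ, hQ1, ?_, ?_⟩
  · intro x
    by_contra hcon
    push Not at hcon
    have := hprod x (-x) hcon.1 hcon.2
    apply this
    have h2 := hQ.sq x
    simpa using h2
  · intro x y h1 h2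
    by_contra hcon
    push Not at hcon
    obtain ⟨hx, hy⟩ := hcon
    have hx' : x ∉ Q ∨ -x ∉ Q := by tauto
    have hy' : y ∉ Q ∨ -y ∉ Q := by tauto
    rcases hx' with hx' | hx' <;> rcases hy' with hy' | hy'
    · exact hprod _ _ hx' hy' h2
    · exact hprod _ _ hx' hy' (by simpa using h1)
    · exact hprod _ _ hx' hy' (by simpa using h1)
    · exact hprod _ _ hx' hy' (by simpa using h2)

end

/-- positive cone of an ordered subfield -/
structure FC {Ω : Type*} [Field Ω] (P : Set Ω) : Prop where
  zero : (0 : Ω) ∈ P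
  one : (1 : Ω) ∈ P
  add : ∀ x ∈ P, ∀ y ∈ P, x + y ∈ P
  mul : ∀ x ∈ P, ∀ y ∈ P, x * y ∈ P
  inv : ∀ x ∈ P, x⁻¹ ∈ P
  anti : ∀ x, x ∈ P → -x ∈ P → x = 0
  diff : ∀ x ∈ P, ∀ y ∈ P, x - y ∈ P ∨ y - x ∈ P

section
variable {A : Type*} [CommRing A] {Ω : Type*} [Field Ω]

lemma fc_of_ordering (Q : Set A) (hQ : Pre Q) (htot : ∀ x, x ∈ Q ∨ -x ∈ Q)
    (hprime : ∀ x y, x * y ∈ Q → -(x * y) ∈ Q → (x ∈ Q ∧ -x ∈ Q) ∨ (y ∈ Q ∧ -y ∈ Q))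
    (θ : A →+* Ω) (hθ : ∀ x, θ x = 0 ↔ x ∈ Q ∧ -x ∈ Q) :
    FC {z | ∃ a ∈ Q, ∃ b ∈ Q, θ b ≠ 0 ∧ z = θ a / θ b} where
  zero := ⟨0, hQ.zero, 1, hQ.one, by simp⟩
  one := ⟨1, hQ.one, 1, hQ.one, by simp⟩
  add := by
    rintro _ ⟨a, ha, b, hb, hb0, rfl⟩ _ ⟨c, hc, d, hd, hd0, rfl⟩
    refine ⟨a * d + b * c, hQ.add _ (hQ.mul _ ha _ hd) _ (hQ.mul _ hb _ hc), b * d,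
      hQ.mul _ hb _ hd, ?_, ?_⟩
    · rw [map_mul]; exact mul_ne_zero hb0 hd0
    · rw [div_add_div _ _ hb0 hd0]; simp
  mul := by
    rintro _ ⟨a, ha, b, hb, hb0, rfl⟩ _ ⟨c, hc, d, hd, hd0, rfl⟩
    refine ⟨a * c, hQ.mul _ ha _ hc, b * d, hQ.mul _ hb _ hd, ?_, ?_⟩
    · rw [map_mul]; exact mul_ne_zero hb0 hd0
    · rw [div_mul_div_comm]; simp
  inv := by
    rintro _ ⟨a, ha, b, hb, hb0, rfl⟩
    by_cases h : θ a = 0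
    · exact ⟨0, hQ.zero, 1, hQ.one, by simp [h]⟩
    · exact ⟨b, hb, a, ha, h, by rw [inv_div]⟩
  anti := by
    rintro _ ⟨a, ha, b, hb, hb0, rfl⟩ ⟨c, hc, d, hd, hd0, e⟩
    have h1 : θ (a * d + b * c) = 0 := by
      rw [map_add, map_mul, map_mul]
      field_simp at e
      linear_combination -e
    rw [hθ] at h1
    have h2 : a * d ∈ Q := hQ.mul _ ha _ hd
    have h3 : -(a * d) ∈ Q := by
      have := hQ.add _ h1.2 _ (hQ.mul _ hb _ hc)
      convert this using 1; ring
    have h4 := (hθ (a * d)).2 ⟨h2, h3⟩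
    rw [map_mul] at h4
    rcases mul_eq_zero.1 h4 with h | h
    · simp [h]
    · exact absurd h hd0
  diff := by
    rintro _ ⟨a, ha, b, hb, hb0, rfl⟩ _ ⟨c, hc, d, hd, hd0, rfl⟩
    have hbd : θ (b * d) ≠ 0 := by rw [map_mul]; exact mul_ne_zero hb0 hd0
    rcases htot (a * d - b * c) with h | h
    · left
      refine ⟨_, h, b * d, hQ.mul _ hb _ hd, hbd, ?_⟩
      rw [div_sub_div _ _ hb0 hd0]; simp
    · right
      refine ⟨_, h, b * d, hQ.mul _ hb _ hd, hbd, ?_⟩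
      rw [div_sub_div _ _ hd0 hb0]; simp; ring

lemma pivt_of_max {E : Type*} [Field E] [LinearOrder E] [IsStrictOrderedRing E] [IsAlgClosed Ω]
    [Algebra E Ω]
    (hmax : ∀ P : Set Ω, FC P → (∀ c : E, 0 ≤ c → algebraMap E Ω c ∈ P) →
      ∀ x ∈ P, ∃ c : E, algebraMap E Ω c = x) : PIVT E := by
  classical
  by_contra hcon
  -- bad polynomials
  have hbad : ∃ n : ℕ, ∃ (p : E[X]) (a b : E), p.natDegree = n ∧ a ≤ b ∧ p.eval a * p.eval b < 0 ∧
      ∀ c, a ≤ c → c ≤ b → p.eval c ≠ 0 := by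
    unfold PIVT at hcon
    push Not at hcon
    obtain ⟨p, a, b, hab, ha, hb, h⟩ := hcon
    refine ⟨_, p, a, b, rfl, hab, ?_, h⟩
    exact mul_neg_of_neg_of_pos (lt_of_le_of_ne ha (h a le_rfl hab))
      (lt_of_le_of_ne hb (h b hab le_rfl).symm)
  obtain ⟨f, a, b, hdeg, hab, hsgn, hnr⟩ := Nat.find_spec hbad
  set d := Nat.find hbad with hd
  have hmin : ∀ (q : E[X]), q.natDegree < d → q.eval a * q.eval b < 0 →
      ∃ c, a ≤ c ∧ c ≤ b ∧ q.eval c = 0 := by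
    intro q hq hs
    by_contra hc
    push Not at hc
    exact Nat.find_min hbad hq ⟨q, a, b, rfl, hab, hs, hc⟩
  have hf0 : f ≠ 0 := by rintro rfl; simp at hsgn
  have hfu : ¬ IsUnit f := by
    intro hu
    obtain ⟨c, -, rfl⟩ := Polynomial.isUnit_iff.1 hu
    simp at hsgn
    nlinarith [mul_self_nonneg c]
  have hirr : Irreducible f := by
    refine ⟨hfu, fun g h hgh => ?_⟩
    by_contra hcon
    push Not at hcon
    obtain ⟨hg, hh⟩ := hcon
    have hg0 : g ≠ 0 := by rintro rfl; simp at hgh; exact hf0 hgh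
    have hh0 : h ≠ 0 := by rintro rfl; simp at hgh; exact hf0 hgh
    have dg : 0 < g.natDegree := natDegree_pos_iff_degree_pos.2 (degree_pos_of_ne_zero_of_nonunit hg0 hg)
    have dh : 0 < h.natDegree := natDegree_pos_iff_degree_pos.2 (degree_pos_of_ne_zero_of_nonunit hh0 hh)
    have hdd : g.natDegree + h.natDegree = d := by rw [← hdeg, hgh, natDegree_mul hg0 hh0]
    have hs : (g.eval a * g.eval b) * (h.eval a * h.eval b) < 0 := by
      rw [hgh] at hsgn
      simp only [eval_mul] at hsgn
      linarith
    rcases lt_or_ge (g.eval a * g.eval b) 0 with hs1 | hs1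
    · obtain ⟨c, h1, h2, h3⟩ := hmin g (by omega) hs1
      exact hnr c h1 h2 (by rw [hgh]; simp [h3])
    · have hs2 : h.eval a * h.eval b < 0 := by
        by_contra h'
        exact absurd (mul_nonneg hs1 (not_lt.1 h')) (not_le.2 hs)
      obtain ⟨c, h1, h2, h3⟩ := hmin h (by omega) hs2
      exact hnr c h1 h2 (by rw [hgh]; simp [h3])
  have hdpos : 0 < d := by
    rw [← hdeg]
    exact natDegree_pos_iff_degree_pos.2 (degree_pos_of_ne_zero_of_nonunit hf0 hfu)
  have hnoroot : ∀ r : E, f.eval r ≠ 0 := by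
    intro r hr
    obtain ⟨u, hu⟩ := dvd_iff_isRoot.2 hr
    have huu : IsUnit u := (hirr.isUnit_or_isUnit hu).resolve_left (not_isUnit_X_sub_C r)
    obtain ⟨c, hc, rfl⟩ := Polynomial.isUnit_iff.1 huu
    have h1 : (a - r) * (b - r) * (c * c) < 0 := by
      rw [hu] at hsgn
      simp at hsgn
      linarith
    have h2 : (a - r) * (b - r) < 0 := by
      by_contra h'
      exact absurd (mul_nonneg (not_lt.1 h') (mul_self_nonneg c)) (not_le.2 h1)
    apply hnr r _ _ hr
    · by_contra h'
      nlinarith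
    · by_contra h'
      nlinarith

  let M : Submonoid E[X] :=
    { carrier := {g | ∃ c : E, 0 ≤ c ∧ ∃ h : E[X], g = C c * (h * h)}
      one_mem' := ⟨1, zero_le_one, 1, by simp⟩
      mul_mem' := by
        rintro _ _ ⟨c, hc, h, rfl⟩ ⟨c', hc', h', rfl⟩
        exact ⟨c * c', mul_nonneg hc hc', h * h', by rw [C_mul]; ring⟩ }
  let S : Subsemiring E[X] := M.subsemiringClosure
  have hMS : ∀ g ∈ M, g ∈ S := fun g hg => by
    rw [Submonoid.subsemiringClosure_mem]; exact AddSubmonoid.subset_closure hg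
  let T : Set E[X] := {g | ∃ s ∈ S, ∃ q, g = s + f * q}
  have hT : Pre T := by
    refine ⟨?_, ?_, ?_⟩
    · rintro _ ⟨s, hs, q, rfl⟩ _ ⟨s', hs', q', rfl⟩
      exact ⟨s + s', add_mem hs hs', q + q', by ring⟩
    · rintro _ ⟨s, hs, q, rfl⟩ _ ⟨s', hs', q', rfl⟩
      exact ⟨s * s', mul_mem hs hs', s * q' + s' * q + f * q * q', by ring⟩
    · intro x
      exact ⟨x * x, hMS _ ⟨1, zero_le_one, x, by simp⟩, 0, by ring⟩
  have hred : ∀ s ∈ S, ∃ s' : E[X], (∃ q, s = s' + f * q) ∧ s'.natDegree ≤ 2 * d - 2 ∧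
      ∀ c, 0 ≤ s'.eval c := by
    intro s hs
    rw [Submonoid.subsemiringClosure_mem] at hs
    induction hs using AddSubmonoid.closure_induction with
    | mem x hx =>
      obtain ⟨c, hc, h, rfl⟩ := hx
      have hh : h = h % f + f * (h / f) := (EuclideanDomain.mod_add_div h f).symm
      refine ⟨C c * ((h % f) * (h % f)),
        ⟨C c * (2 * (h % f) * (h / f) + f * (h / f) * (h / f)), ?_⟩, ?_, ?_⟩
      · conv_lhs => rw [hh]
        ring
      · have h1 : (h % f).natDegree < d := by
          rw [← hdeg]
          exact Polynomial.natDegree_mod_lt h (by omega)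
        have h2 := natDegree_C_mul_le c ((h % f) * (h % f))
        have h3 := natDegree_mul_le (p := h % f) (q := h % f)
        omega
      · intro x
        simp only [eval_mul, eval_C]
        exact mul_nonneg hc (mul_self_nonneg _)
    | zero => exact ⟨0, ⟨0, by simp⟩, by simp, by simp⟩
    | add x y _ _ hx hy =>
      obtain ⟨s1, ⟨q1, e1⟩, d1, p1⟩ := hx
      obtain ⟨s2, ⟨q2, e2⟩, d2, p2⟩ := hy
      refine ⟨s1 + s2, ⟨q1 + q2, by rw [e1, e2]; ring⟩, natDegree_add_le_of_degree_le d1 d2, ?_⟩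
      intro c
      rw [eval_add]
      exact add_nonneg (p1 c) (p2 c)
  have hT1 : (-1 : E[X]) ∉ T := by
    rintro ⟨s, hs, q, e⟩
    obtain ⟨s', ⟨q', e'⟩, hd', hp'⟩ := hred s hs
    set w := -(q + q') with hw
    have hfw : f * w = 1 + s' := by rw [hw]; linear_combination e + e'
    have hpos : ∀ c, 0 < f.eval c * w.eval c := by
      intro c
      have := congrArg (eval c) hfw
      simp only [eval_mul, eval_add, eval_one] at this
      rw [this]
      linarith [hp' c]
    have hw0 : w ≠ 0 := by
      intro h
      have := hpos 0
      rw [h] at this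
      simp at this
    have hdw : w.natDegree < d := by
      have h1 := natDegree_mul hf0 hw0
      rw [hfw] at h1
      have h2 : (1 + s').natDegree ≤ 2 * d - 2 :=
        natDegree_add_le_of_degree_le (by simp) hd'
      omega
    have hs : w.eval a * w.eval b < 0 := by
      by_contra h'
      have h1 := mul_pos (hpos a) (hpos b)
      have h2 := mul_nonneg (not_lt.1 h') (neg_nonneg.2 hsgn.le)
      nlinarith
    obtain ⟨c, -, -, hc⟩ := hmin w hdw hs
    have := hpos c
    rw [hc] at this
    simp at this
  obtain ⟨Q, hTQ, hQ, hQ1, htot, hprime⟩ := exists_ordering T hT hT1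
  obtain ⟨z, hz⟩ := IsAlgClosed.exists_aeval_eq_zero Ω f (by
    intro h
    have := natDegree_eq_zero_iff_degree_le_zero.2 h.le
    omega)
  have hfQ : ∀ q, f * q ∈ Q ∧ -(f * q) ∈ Q := by
    intro q
    exact ⟨hTQ ⟨0, zero_mem _, q, by ring⟩, hTQ ⟨0, zero_mem _, -q, by ring⟩⟩
  have hker : ∀ x : E[X], (aeval z : E[X] →ₐ[E] Ω).toRingHom x = 0 ↔ x ∈ Q ∧ -x ∈ Q := by
    intro x
    change aeval z x = 0 ↔ _
    constructor
    · intro hx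
      have hdvd : f ∣ x := by
        by_contra hnd
        obtain ⟨u, v, huv⟩ := (hirr.coprime_iff_not_dvd.2 hnd)
        have := congrArg (aeval z) huv
        simp [hx, hz] at this
      obtain ⟨q, rfl⟩ := hdvd
      exact hfQ q
    · rintro ⟨hx1, hx2⟩
      by_contra hne
      have hnd : ¬ f ∣ x := by
        rintro ⟨q, rfl⟩
        apply hne
        simp [hz]
      obtain ⟨u, v, huv⟩ := (hirr.coprime_iff_not_dvd.2 hnd)
      -- -1 = -(u f) - v x
      have hvx : -(v * x) ∈ Q := by
        rcases htot v with h | h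
        · have := hQ.mul _ h _ hx2
          simpa using this
        · have := hQ.mul _ h _ hx1
          simpa using this
      have := hQ.add _ (hfQ u).2 _ hvx
      apply hQ1
      convert this using 1
      linear_combination huv
  have hFC := fc_of_ordering Q hQ htot hprime _ hker
  have hsub : ∀ x ∈ Q, aeval z x ∈ {y : Ω | ∃ a ∈ Q, ∃ b ∈ Q,
      (aeval z : E[X] →ₐ[E] Ω).toRingHom b ≠ 0 ∧
      y = (aeval z : E[X] →ₐ[E] Ω).toRingHom a / (aeval z : E[X] →ₐ[E] Ω).toRingHom b} := by
    intro x hx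
    refine ⟨x, hx, 1, hQ.one, by simp, ?_⟩
    rw [map_one, div_one]; rfl
  have hfin := hmax _ hFC (by
    intro c hc
    have := hsub (C c) (hTQ ⟨C c, hMS _ ⟨c, hc, 1, by simp⟩, 0, by ring⟩)
    simpa using this)
  have hzE : ∃ c : E, algebraMap E Ω c = z := by
    rcases htot X with h | h
    · exact hfin z (by simpa using hsub X h)
    · obtain ⟨c, hc⟩ := hfin (-z) (by simpa using hsub (-X) h)
      exact ⟨-c, by rw [map_neg, hc, neg_neg]⟩
  obtain ⟨c, rfl⟩ := hzE
  rw [aeval_algebraMap_apply] at hz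
  apply hnoroot c
  have := (map_eq_zero (algebraMap E Ω)).1 hz
  simpa using this

end
end SparseSchm

namespace SparseSchm

section
universe u
variable {Ω : Type u} [Field Ω]

/-- the subfield generated by a field cone -/
def FC.sub {P : Set Ω} (h : FC P) : Subfield Ω where
  carrier := {x | x ∈ P ∨ -x ∈ P}
  zero_mem' := Or.inl h.zero
  one_mem' := Or.inl h.one
  mul_mem' := by
    rintro x y (hx | hx) (hy | hy)
    · exact Or.inl (h.mul _ hx _ hy)
    · right; simpa using h.mul _ hx _ hy
    · right; simpa using h.mul _ hx _ hy
    · left; simpa using h.mul _ hx _ hy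
  add_mem' := by
    rintro x y (hx | hx) (hy | hy)
    · exact Or.inl (h.add _ hx _ hy)
    · rcases h.diff _ hx _ hy with h1 | h1
      · left; convert h1 using 1; ring
      · right; convert h1 using 1; ring
    · rcases h.diff _ hy _ hx with h1 | h1
      · left; convert h1 using 1; ring
      · right; convert h1 using 1; ring
    · right; convert h.add _ hx _ hy using 1; ring
  neg_mem' := by
    rintro x (hx | hx)
    · right; simpa using hx
    · left; exact hx
  inv_mem' := by
    rintro x (hx | hx)
    · left; exact h.inv _ hx
    · right; rw [neg_inv]; exact h.inv _ hx

lemma FC.mem_sub {P : Set Ω} (h : FC P) (x : Ω) : x ∈ h.sub ↔ x ∈ P ∨ -x ∈ P := Iff.rfl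

open Classical in
/-- the order on the subfield of a field cone -/
@[reducible] noncomputable def FC.order {P : Set Ω} (h : FC P) : LinearOrder h.sub where
  le x y := (y : Ω) - x ∈ P
  le_refl x := by simpa using h.zero
  le_trans x y z hxy hyz := by
    have := h.add _ hxy _ hyz
    simpa using this
  le_antisymm x y hxy hyx := by
    have := h.anti _ hxy (by simpa using hyx)
    exact Subtype.ext (sub_eq_zero.1 this).symm
  le_total x y := by
    rcases (h.sub.sub_mem y.2 x.2) with h1 | h1
    · exact Or.inl h1
    · right; simpa using h1
  toDecidableLE := fun _ _ => Classical.dec _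

lemma FC.le_iff {P : Set Ω} (h : FC P) (x y : h.sub) : h.order.le x y ↔ (y : Ω) - x ∈ P := Iff.rfl

lemma FC.strict {P : Set Ω} (h : FC P) :
    @IsStrictOrderedRing h.sub _ h.order.toPartialOrder := by
  letI := h.order
  have hle : ∀ x y : h.sub, x ≤ y ↔ (y : Ω) - x ∈ P := fun x y => Iff.rfl
  haveI : IsOrderedAddMonoid h.sub := ⟨fun a b hab c => by
    rw [hle] at hab ⊢; simpa using hab, fun a b hab c => by
    rw [hle] at hab ⊢; simpa using hab⟩
  haveI : ZeroLEOneClass h.sub := ⟨by rw [hle]; simpa using h.one⟩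
  refine IsStrictOrderedRing.of_mul_pos ?_
  intro a b ha hb
  refine lt_of_le_of_ne ?_ (mul_ne_zero ha.ne' hb.ne').symm
  have h1 := (hle _ _).1 ha.le
  have h2 := (hle _ _).1 hb.le
  rw [hle]
  simp only [ZeroMemClass.coe_zero, sub_zero] at h1 h2
  simpa using h.mul _ h1 _ h2

lemma exists_rcf [IsAlgClosed Ω] (P0 : Set Ω) (h0 : FC P0) :
    ∃ (P : Set Ω) (h : FC P), P0 ⊆ P ∧ @PIVT h.sub _ h.order := by
  obtain ⟨P, hP0, hPmax⟩ := zorn_subset_nonempty {P : Set Ω | FC P} (by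
    intro c hc hchain hne
    obtain ⟨s0, hs0⟩ := hne
    have key : ∀ x ∈ ⋃₀ c, ∀ y ∈ ⋃₀ c, ∃ s ∈ c, x ∈ s ∧ y ∈ s := by
      rintro x ⟨s, hs, hx⟩ y ⟨t, ht, hy⟩
      rcases hchain.total hs ht with h | h
      · exact ⟨t, ht, h hx, hy⟩
      · exact ⟨s, hs, hx, h hy⟩
    refine ⟨⋃₀ c, ⟨⟨s0, hs0, (hc hs0).zero⟩, ⟨s0, hs0, (hc hs0).one⟩, ?_, ?_, ?_, ?_, ?_⟩,
      fun s hs => Set.subset_sUnion_of_mem hs⟩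
    · intro x hx y hy
      obtain ⟨s, hs, h1, h2⟩ := key x hx y hy
      exact ⟨s, hs, (hc hs).add _ h1 _ h2⟩
    · intro x hx y hy
      obtain ⟨s, hs, h1, h2⟩ := key x hx y hy
      exact ⟨s, hs, (hc hs).mul _ h1 _ h2⟩
    · rintro x ⟨s, hs, h1⟩
      exact ⟨s, hs, (hc hs).inv _ h1⟩
    · intro x hx hy
      obtain ⟨s, hs, h1, h2⟩ := key x hx _ hy
      exact (hc hs).anti _ h1 h2
    · intro x hx y hy
      obtain ⟨s, hs, h1, h2⟩ := key x hx y hy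
      rcases (hc hs).diff _ h1 _ h2 with h | h
      · exact Or.inl ⟨s, hs, h⟩
      · exact Or.inr ⟨s, hs, h⟩) P0 h0
  have hP : FC P := hPmax.prop
  refine ⟨P, hP, hP0, ?_⟩
  letI := hP.order
  letI := hP.strict
  apply pivt_of_max (Ω := Ω)
  intro P' hP' hsub x hx
  have hPP' : P ⊆ P' := by
    intro y hy
    exact hsub ⟨y, Or.inl hy⟩ (by
      change (y : Ω) - ((0 : hP.sub) : Ω) ∈ P
      simpa using hy)
  have := hPmax.le_of_ge hP' hPP' hx
  exact ⟨⟨x, Or.inl this⟩, rfl⟩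
end

/-- the support of an ordering -/
def supp {A : Type*} [CommRing A] (Q : Set A) (hQ : Pre Q) (htot : ∀ x, x ∈ Q ∨ -x ∈ Q) :
    Ideal A where
  carrier := {x | x ∈ Q ∧ -x ∈ Q}
  zero_mem' := ⟨hQ.zero, by simpa using hQ.zero⟩
  add_mem' := by
    rintro x y ⟨hx, hx'⟩ ⟨hy, hy'⟩
    refine ⟨hQ.add _ hx _ hy, ?_⟩
    have := hQ.add _ hx' _ hy'
    convert this using 1; ring
  smul_mem' := by
    rintro c x ⟨hx, hx'⟩
    rcases htot c with hc | hc
    · refine ⟨hQ.mul _ hc _ hx, ?_⟩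
      have := hQ.mul _ hc _ hx'
      convert this using 1; simp
    · refine ⟨?_, ?_⟩
      · have := hQ.mul _ hc _ hx'
        convert this using 1; simp
      · have := hQ.mul _ hc _ hx
        convert this using 1; simp

lemma exists_rcf_hom {A : Type} [CommRing A] (Q : Set A) (hQ : Pre Q) (h1 : (-1 : A) ∉ Q)
    (htot : ∀ x, x ∈ Q ∨ -x ∈ Q)
    (hprime : ∀ x y, x * y ∈ Q → -(x * y) ∈ Q → (x ∈ Q ∧ -x ∈ Q) ∨ (y ∈ Q ∧ -y ∈ Q)) :
    ∃ (E : Type) (_ : Field E) (_ : LinearOrder E) (_ : IsStrictOrderedRing E), PIVT E ∧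
      ∃ θ : A →+* E, ∀ a ∈ Q, 0 ≤ θ a := by
  set p := supp Q hQ htot with hp
  haveI : p.IsPrime := by
    refine ⟨?_, ?_⟩
    · intro h
      have : (1 : A) ∈ p := by rw [h]; trivial
      exact h1 this.2
    · intro x y hxy
      exact hprime x y hxy.1 hxy.2
  let F := FractionRing (A ⧸ p)
  let Ω := AlgebraicClosure F
  let θ : A →+* Ω := ((algebraMap F Ω).comp (algebraMap (A ⧸ p) F)).comp (Ideal.Quotient.mk p)
  have hθ : ∀ x, θ x = 0 ↔ x ∈ Q ∧ -x ∈ Q := by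
    intro x
    have : θ x = (algebraMap F Ω) (algebraMap (A ⧸ p) F (Ideal.Quotient.mk p x)) := rfl
    rw [this, map_eq_zero_iff _ (algebraMap F Ω).injective,
      map_eq_zero_iff _ (IsFractionRing.injective (A ⧸ p) F), Ideal.Quotient.eq_zero_iff_mem]
    rfl
  have h0 := fc_of_ordering Q hQ htot hprime θ hθ
  obtain ⟨P, h, hsub, hpivt⟩ := exists_rcf _ h0
  have hQP : ∀ a ∈ Q, θ a ∈ P := fun a ha => hsub ⟨a, ha, 1, hQ.one, by simp, by simp⟩
  refine ⟨h.sub, inferInstance, h.order, h.strict, hpivt, θ.codRestrict h.sub ?_, ?_⟩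
  · intro x
    rcases htot x with hx | hx
    · exact Or.inl (hQP x hx)
    · right; simpa using hQP _ hx
  · intro a ha
    change (θ a : Ω) - ((0 : h.sub) : Ω) ∈ P
    simpa using hQP a ha

lemma krivine {σ ι : Type} [Finite σ] [Finite ι] (T : Set (MvPolynomial σ ℝ)) (hT : Pre T)
    (h1 : (-1 : MvPolynomial σ ℝ) ∉ T) (G : ι → MvPolynomial σ ℝ) (hG : ∀ i, G i ∈ T) :
    ∃ x : σ → ℝ, ∀ i, 0 ≤ MvPolynomial.eval x (G i) := by
  obtain ⟨Q, hTQ, hQ, hQ1, htot, hprime⟩ := exists_ordering T hT h1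
  obtain ⟨E, _, _, _, hE, θ, hθ⟩ := exists_rcf_hom Q hQ hQ1 htot hprime
  refine transfer hE (θ.comp MvPolynomial.C) G (fun i => θ (MvPolynomial.X i)) ?_
  intro i
  have : MvPolynomial.eval₂ (θ.comp MvPolynomial.C) (fun i => θ (MvPolynomial.X i)) (G i)
      = θ (G i) := by
    have := MvPolynomial.eval₂_comp_left θ MvPolynomial.C MvPolynomial.X (G i)
    rw [MvPolynomial.eval₂_eta] at this
    exact this.symm
  rw [this]
  exact hθ _ (hTQ (hG i))

end SparseSchm

namespace SparseSchm
open MvPolynomial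

section
variable {σ ι : Type} {T : Set (MvPolynomial σ ℝ)}

lemma Pre.const (hT : Pre T) {c : ℝ} (hc : 0 ≤ c) : (C c : MvPolynomial σ ℝ) ∈ T := by
  have := hT.sq (C (Real.sqrt c))
  rwa [← C_mul, Real.mul_self_sqrt hc] at this

lemma Pre.sumsq (hT : Pre T) (s : Finset σ) : (∑ i ∈ s, X i * X i : MvPolynomial σ ℝ) ∈ T := by
  classical
  induction s using Finset.induction_on with
  | empty => simpa using hT.zero
  | insert a s ha ih =>
    rw [Finset.sum_insert ha]
    exact hT.add _ (hT.sq _) _ ih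

lemma half : (C (1/2 : ℝ) : MvPolynomial σ ℝ) * 2 = 1 := by
  have : (2 : MvPolynomial σ ℝ) = C 2 := (map_ofNat C 2).symm
  rw [this, ← C_mul]; norm_num

lemma arch [Fintype σ] (hT : Pre T) (N : ℝ)
    (h : (C N - ∑ i, X i * X i : MvPolynomial σ ℝ) ∈ T) (p : MvPolynomial σ ℝ) :
    ∃ k : ℝ, C k - p ∈ T ∧ C k + p ∈ T := by
  classical
  induction p using MvPolynomial.induction_on with
  | C a =>
    refine ⟨|a|, ?_, ?_⟩
    · rw [← C_sub]; exact hT.const (by linarith [le_abs_self a])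
    · rw [← C_add]; exact hT.const (by linarith [neg_abs_le a])
  | add p q hp hq =>
    obtain ⟨k, h1, h2⟩ := hp
    obtain ⟨l, h3, h4⟩ := hq
    refine ⟨k + l, ?_, ?_⟩
    · convert hT.add _ h1 _ h3 using 1; rw [C_add]; ring
    · convert hT.add _ h2 _ h4 using 1; rw [C_add]; ring
  | mul_X p i hp =>
    obtain ⟨k, h1, h2⟩ := hp
    have hX : (C N - X i * X i : MvPolynomial σ ℝ) ∈ T := by
      have := hT.add _ h _ (hT.sumsq (Finset.univ.erase i))
      convert this using 1
      rw [← Finset.add_sum_erase _ _ (Finset.mem_univ i)]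
      ring
    have h14 : (C (1/4 : ℝ) : MvPolynomial σ ℝ) = C (1/2) * C (1/2) := by
      rw [← C_mul]; norm_num
    have h3 : (C (N + 1/4) - X i : MvPolynomial σ ℝ) ∈ T := by
      convert hT.add _ hX _ (hT.sq (X i - C (1/2))) using 1
      rw [C_add, h14]
      linear_combination (X i) * half (σ := σ)
    have h4 : (C (N + 1/4) + X i : MvPolynomial σ ℝ) ∈ T := by
      convert hT.add _ hX _ (hT.sq (X i + C (1/2))) using 1
      rw [C_add, h14]
      linear_combination -(X i) * half (σ := σ)
    have hh : (C (1/2 : ℝ) : MvPolynomial σ ℝ) ∈ T := hT.const (by norm_num)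
    refine ⟨k * (N + 1/4), ?_, ?_⟩
    · convert hT.mul _ hh _ (hT.add _ (hT.mul _ h2 _ h3) _ (hT.mul _ h1 _ h4)) using 1
      rw [C_mul]
      linear_combination (-(C k * C (N + 1/4)) + p * X i) * half (σ := σ)
    · convert hT.mul _ hh _ (hT.add _ (hT.mul _ h2 _ h4) _ (hT.mul _ h1 _ h3)) using 1
      rw [C_mul]
      linear_combination (-(C k * C (N + 1/4)) - p * X i) * half (σ := σ)

lemma krivine' [Finite σ] [Finite ι] (hT : Pre T) (g : ι → MvPolynomial σ ℝ) (hg : ∀ i, g i ∈ T)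
    (f : MvPolynomial σ ℝ) (hf : ∀ x, (∀ i, 0 ≤ eval x (g i)) → eval x f < 0) :
    ∃ a ∈ T, ∃ b ∈ T, -1 = a + f * b := by
  by_contra hcon
  obtain ⟨x, hx⟩ := krivine _ (hT.adjoin f) hcon (fun i : Option ι => i.elim f g) (by
    intro i
    cases i with
    | none => exact ⟨0, hT.zero, 1, hT.one, by simp⟩
    | some i => exact ⟨g i, hg i, 0, hT.zero, by simp⟩)
  have h1 := hf x (fun i => hx (some i))
  have h2 := hx none
  simp only [Option.elim] at h2
  linarith

lemma arch' [Fintype σ] [Finite ι] (hT : Pre T) (g : ι → MvPolynomial σ ℝ) (hg : ∀ i, g i ∈ T)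
    (r : ℝ) (hr0 : 0 ≤ r) (hr : ∀ x : σ → ℝ, (∀ i, 0 ≤ eval x (g i)) → ∑ i, x i * x i < r)
    (p : MvPolynomial σ ℝ) : ∃ k : ℝ, C k - p ∈ T ∧ C k + p ∈ T := by
  set s : MvPolynomial σ ℝ := ∑ i, X i * X i with hs
  have hsT : s ∈ T := hT.sumsq _
  obtain ⟨a, ha, b, hb, hab⟩ := krivine' hT g hg (s - C r) (by
    intro x hx
    have := hr x hx
    simp [hs]
    linarith)
  obtain ⟨k, hk, -⟩ := arch (hT.adjoin (C r - s)) r ⟨0, hT.zero, 1, hT.one, by ring⟩ a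
  obtain ⟨u, hu, v, hv, huv⟩ := hk
  -- (1+a)(k-a) ∈ T
  have h1a : 1 + a ∈ T := hT.add _ hT.one _ ha
  have h1 : (1 + a) * (C k - a) ∈ T := by
    have := hT.add _ (hT.mul _ h1a _ hu) _ (hT.mul _ (hT.mul _ hb _ (hT.sq (C r - s))) _ hv)
    convert this using 1
    rw [huv]
    linear_combination (C r - s) * v * (-hab)
  have h2 : C (k + k * k / 4) - a ∈ T := by
    have := hT.add _ h1 _ (hT.sq (a - C (k / 2)))
    convert this using 1
    have e1 : (C k : MvPolynomial σ ℝ) = C (k/2) * 2 := by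
      have : (2 : MvPolynomial σ ℝ) = C 2 := (map_ofNat C 2).symm
      rw [this, ← C_mul]; congr 1; ring
    have e2 : (C (k * k / 4) : MvPolynomial σ ℝ) = C (k/2) * C (k/2) := by
      rw [← C_mul]; congr 1; ring
    rw [C_add, e1, e2]; ring
  set k' := k + k * k / 4
  have h3 : C (r + r * k') - s ∈ T := by
    have h4 : b * ((C r - s) * (C r - s)) ∈ T := hT.mul _ hb _ (hT.sq _)
    have e : b * (C r - s) = 1 + a := by linear_combination hab
    have h5 : (1 + a) * (C r - s) ∈ T := by
      convert h4 using 1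
      rw [← e]; ring
    have := hT.add _ (hT.add _ h5 _ (hT.mul _ hsT _ ha)) _ (hT.mul _ (hT.const hr0) _ h2)
    convert this using 1
    rw [C_add, C_mul]; ring
  exact arch hT _ h3 p

theorem schmuedgen [Fintype σ] [Finite ι] (hT : Pre T) (g : ι → MvPolynomial σ ℝ)
    (hg : ∀ i, g i ∈ T) (r : ℝ) (hr0 : 0 ≤ r)
    (hr : ∀ x : σ → ℝ, (∀ i, 0 ≤ eval x (g i)) → ∑ i, x i * x i < r)
    (p : MvPolynomial σ ℝ) (hp : ∀ x, (∀ i, 0 ≤ eval x (g i)) → 0 < eval x p) : p ∈ T := by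
  obtain ⟨t', ht', t, ht, htt⟩ := krivine' hT g hg (-p) (by
    intro x hx
    have := hp x hx
    simp; linarith)
  obtain ⟨k0, hk0, -⟩ := arch' hT g hg r hr0 hr t
  obtain ⟨r0, -, hr0'⟩ := arch' hT g hg r hr0 hr p
  set k := |k0| + 1
  have hkpos : 0 < k := by positivity
  have hk : C k - t ∈ T := by
    have := hT.add _ hk0 _ (hT.const (c := k - k0) (by
      have := le_abs_self k0
      simp only [k]; linarith))
    convert this using 1
    rw [C_sub]; ring
  have step : ∀ q : ℝ, 0 ≤ q → C q + p ∈ T → C (q - 1/k) + p ∈ T := by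
    intro q hq h
    have h1 : (C k - t) * (C q + p) + (t' + C q * t) ∈ T :=
      hT.add _ (hT.mul _ hk _ h) _ (hT.add _ ht' _ (hT.mul _ (hT.const hq) _ ht))
    have h2 := hT.mul _ (hT.const (c := 1/k) (by positivity)) _ h1
    convert h2 using 1
    have e : (C (1/k) : MvPolynomial σ ℝ) * C k = 1 := by
      rw [← C_mul, one_div, inv_mul_cancel₀ hkpos.ne', C_1]
    rw [C_sub]
    linear_combination (-C q - p) * e + C (1/k) * htt
  have up : ∀ q q' : ℝ, q ≤ q' → C q + p ∈ T → C q' + p ∈ T := by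
    intro q q' hqq h
    convert hT.add _ h _ (hT.const (c := q' - q) (by linarith)) using 1
    rw [C_sub]; ring
  have main : ∀ n : ℕ, ∀ q : ℝ, q ≤ n / k → C q + p ∈ T → p ∈ T := by
    intro n
    induction n with
    | zero =>
      intro q hq h
      have := up q 0 (by simpa using hq) h
      simpa using this
    | succ n ih =>
      intro q hq h
      by_cases h0 : 0 ≤ q
      · refine ih (q - 1/k) ?_ (step q h0 h)
        push_cast at hq
        rw [add_div] at hq
        linarith
      · have := up q 0 (by linarith) h
        simpa using this
  obtain ⟨n, hn⟩ := exists_nat_ge (r0 * k)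
  exact main n r0 (by rwa [le_div_iff₀ hkpos]) hr0'
end

/-- uniform polynomial approximation -/
lemma stone_weierstrass {σ : Type} [Finite σ] (L : Set (σ → ℝ)) (hL : IsCompact L)
    (u : (σ → ℝ) → ℝ) (hu : Continuous u) (ε : ℝ) (hε : 0 < ε) :
    ∃ q : MvPolynomial σ ℝ, ∀ x ∈ L, |eval x q - u x| < ε := by
  haveI : CompactSpace L := isCompact_iff_compactSpace.1 hL
  let Φ : MvPolynomial σ ℝ →ₐ[ℝ] C(L, ℝ) :=
    aeval (fun i => (⟨fun x => (x : σ → ℝ) i,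
      (continuous_apply i).comp continuous_subtype_val⟩ : C(L, ℝ)))
  have hΦ : ∀ q x, Φ q x = eval (x : σ → ℝ) q := by
    intro q x
    induction q using MvPolynomial.induction_on with
    | C a => simp [Φ, _root_.algebraMap_apply]
    | add p q hp hq => simp [hp, hq]
    | mul_X p i hp => simp [hp]; left; simp [Φ]
  obtain ⟨⟨_, q, rfl⟩, hq⟩ :=
    ContinuousMap.exists_mem_subalgebra_near_continuous_of_separatesPoints Φ.range (by
      intro x y hxy
      obtain ⟨i, hi⟩ : ∃ i, (x : σ → ℝ) i ≠ (y : σ → ℝ) i := by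
        by_contra! h
        exact hxy (Subtype.ext (funext h))
      refine ⟨_, ⟨Φ (X i), ⟨X i, rfl⟩, rfl⟩, ?_⟩
      simpa [hΦ] using hi) (fun x => u x) (hu.comp continuous_subtype_val) ε hε
  refine ⟨q, fun x hx => ?_⟩
  have := hq ⟨x, hx⟩
  rw [← hΦ q ⟨x, hx⟩]
  exact this

end SparseSchm

open MvPolynomial

namespace SparseSchm

section
variable {ι κ : Type*}

lemma isSOS_of {τ : Type*} [Fintype τ] (s : τ → MvPolynomial ι ℝ) : IsSOS (∑ i, (s i) ^ 2) := by
  refine ⟨Fintype.card τ, fun i => s ((Fintype.equivFin τ).symm i), ?_⟩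
  exact ((Fintype.equivFin τ).symm.sum_comp (fun i => (s i) ^ 2)).symm

lemma isSOS_add {p q : MvPolynomial ι ℝ} (hp : IsSOS p) (hq : IsSOS q) : IsSOS (p + q) := by
  obtain ⟨k, s, rfl⟩ := hp
  obtain ⟨l, t, rfl⟩ := hq
  have := isSOS_of (Sum.elim s t)
  rwa [Fintype.sum_sum_type] at this

lemma isSOS_mul {p q : MvPolynomial ι ℝ} (hp : IsSOS p) (hq : IsSOS q) : IsSOS (p * q) := by
  obtain ⟨k, s, rfl⟩ := hp
  obtain ⟨l, t, rfl⟩ := hq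
  have := isSOS_of (fun i : Fin k × Fin l => s i.1 * t i.2)
  rw [Fintype.sum_prod_type] at this
  rw [Finset.sum_mul_sum]
  simpa only [mul_pow] using this

lemma isSOS_sq (p : MvPolynomial ι ℝ) : IsSOS (p ^ 2) := ⟨1, fun _ => p, by simp⟩

lemma isSOS_zero : IsSOS (0 : MvPolynomial ι ℝ) := by simpa using isSOS_sq (0 : MvPolynomial ι ℝ)

lemma isSOS_eval_nonneg {p : MvPolynomial ι ℝ} (hp : IsSOS p) (x : ι → ℝ) : 0 ≤ eval x p := by
  obtain ⟨k, s, rfl⟩ := hp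
  rw [map_sum]
  exact Finset.sum_nonneg fun i _ => by rw [map_pow]; positivity

variable [Fintype κ] [DecidableEq κ] (g : κ → MvPolynomial ι ℝ)

lemma inPre_nonneg {σ : MvPolynomial ι ℝ} (h : InPreordering g σ) (x : ι → ℝ)
    (hx : ∀ j, 0 ≤ eval x (g j)) : 0 ≤ eval x σ := by
  obtain ⟨c, hc, rfl⟩ := h
  rw [map_sum]
  refine Finset.sum_nonneg fun J _ => ?_
  rw [map_mul, map_prod]
  exact mul_nonneg (isSOS_eval_nonneg (hc J) x) (Finset.prod_nonneg fun j _ => hx j)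

lemma inPre_add {σ τ : MvPolynomial ι ℝ} (h : InPreordering g σ) (h' : InPreordering g τ) :
    InPreordering g (σ + τ) := by
  obtain ⟨c, hc, rfl⟩ := h
  obtain ⟨d, hd, rfl⟩ := h'
  refine ⟨fun J => c J + d J, fun J => isSOS_add (hc J) (hd J), ?_⟩
  rw [← Finset.sum_add_distrib]
  exact Finset.sum_congr rfl fun J _ => by ring

lemma inPre_single {q : MvPolynomial ι ℝ} (hq : IsSOS q) (J : Finset κ) :
    InPreordering g (q * ∏ j ∈ J, g j) := by
  refine ⟨fun K => if K = J then q else 0, fun K => ?_, ?_⟩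
  · dsimp only
    split_ifs
    · exact hq
    · exact isSOS_zero
  · simp [ite_mul]

lemma inPre_zero : InPreordering g 0 := by simpa using inPre_single g isSOS_zero ∅

lemma inPre_sum {τ : Type*} (s : Finset τ) (F : τ → MvPolynomial ι ℝ)
    (h : ∀ i ∈ s, InPreordering g (F i)) : InPreordering g (∑ i ∈ s, F i) := by
  classical
  induction s using Finset.induction_on with
  | empty => simpa using inPre_zero g
  | insert a s ha ih =>
    rw [Finset.sum_insert ha]
    exact inPre_add g (h a (by simp)) (ih fun i hi => h i (by simp [hi]))

lemma prod_mul_prod (J K : Finset κ) : (∏ j ∈ J, g j) * ∏ j ∈ K, g j =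
    (∏ j ∈ J ∩ K, g j) ^ 2 * ∏ j ∈ (J \ K) ∪ (K \ J), g j := by
  have h1 : (∏ j ∈ J \ K, g j) * ∏ j ∈ J ∩ K, g j = ∏ j ∈ J, g j := by
    rw [mul_comm]; exact Finset.prod_inter_mul_prod_diff J K g
  have h2 : (∏ j ∈ K \ J, g j) * ∏ j ∈ J ∩ K, g j = ∏ j ∈ K, g j := by
    rw [mul_comm, Finset.inter_comm]; exact Finset.prod_inter_mul_prod_diff K J g
  rw [← h1, ← h2, Finset.prod_union (by
    rw [Finset.disjoint_left]
    intro x hx hx'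
    simp only [Finset.mem_sdiff] at hx hx'
    exact hx.2 hx'.1)]
  ring

lemma inPre_pre : Pre {σ | InPreordering g σ} where
  add := fun x hx y hy => inPre_add g hx hy
  mul := by
    rintro _ ⟨c, hc, rfl⟩ _ ⟨d, hd, rfl⟩
    simp only [Set.mem_setOf_eq]
    rw [Finset.sum_mul_sum]
    refine inPre_sum g _ _ fun J _ => inPre_sum g _ _ fun K _ => ?_
    have : c J * (∏ j ∈ J, g j) * (d K * ∏ j ∈ K, g j) =
        (c J * d K * (∏ j ∈ J ∩ K, g j) ^ 2) * ∏ j ∈ (J \ K) ∪ (K \ J), g j := by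
      linear_combination c J * d K * prod_mul_prod g J K
    rw [this]
    exact inPre_single g (isSOS_mul (isSOS_mul (hc J) (hd K)) (isSOS_sq _)) _
  sq := fun x => by simpa [pow_two] using inPre_single g (isSOS_sq x) ∅

lemma inPre_gen (j : κ) : InPreordering g (g j) := by
  simpa using inPre_single g (isSOS_sq 1) {j}
end

lemma exists_between_compact (S₁ S₂ : Set ℝ) (h₁ : IsCompact S₁) (h₂ : IsCompact S₂)
    (h : ∀ a ∈ S₂, ∀ b ∈ S₁, a < b) : ∃ c, (∀ b ∈ S₁, c < b) ∧ ∀ a ∈ S₂, a < c := by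
  rcases S₁.eq_empty_or_nonempty with rfl | hn₁
  · obtain ⟨M, hM⟩ := h₂.bddAbove
    exact ⟨M + 1, by simp, fun a ha => by have := hM ha; linarith⟩
  rcases S₂.eq_empty_or_nonempty with rfl | hn₂
  · obtain ⟨M, hM⟩ := h₁.bddBelow
    exact ⟨M - 1, fun b hb => by have := hM hb; linarith, by simp⟩
  obtain ⟨l, hl, hl'⟩ := h₁.exists_isLeast hn₁
  obtain ⟨u, hu, hu'⟩ := h₂.exists_isGreatest hn₂
  obtain ⟨c, hc, hc'⟩ := exists_between (h u hu l hl)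
  exact ⟨c, fun b hb => lt_of_lt_of_le hc' (hl' hb), fun a ha => lt_of_le_of_lt (hu' ha) hc⟩

lemma split_poly {α β σ : Type} [Finite σ] [TopologicalSpace α] [TopologicalSpace β]
    [T2Space α] [T2Space β]
    (A : Set (α × (σ → ℝ))) (B : Set ((σ → ℝ) × β)) (hA : IsCompact A) (hB : IsCompact B)
    (F : α × (σ → ℝ) → ℝ) (G : (σ → ℝ) × β → ℝ) (hF : Continuous F) (hG : Continuous G)
    (h : ∀ x y z, (x, y) ∈ A → (y, z) ∈ B → G (y, z) < F (x, y)) :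
    ∃ q : MvPolynomial σ ℝ, (∀ w ∈ A, eval w.2 q < F w) ∧ (∀ w ∈ B, G w < eval w.1 q) := by
  haveI := Fintype.ofFinite σ
  let t : (σ → ℝ) → Set ℝ := fun y =>
    {c | (∀ w ∈ A, w.2 = y → c < F w) ∧ (∀ w ∈ B, w.1 = y → G w < c)}
  have htc : ∀ y, Convex ℝ (t y) := by
    intro y
    have : t y = (⋂ w ∈ {w | w ∈ A ∧ w.2 = y}, Set.Iio (F w)) ∩
        (⋂ w ∈ {w | w ∈ B ∧ w.1 = y}, Set.Ioi (G w)) := by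
      ext c; simp [t]
    rw [this]
    exact (convex_iInter₂ fun _ _ => convex_Iio _).inter (convex_iInter₂ fun _ _ => convex_Ioi _)
  obtain ⟨u, hu⟩ := exists_continuous_forall_mem_convex_of_local_const htc (by
    intro y
    have c1 : IsClosed {w : α × (σ → ℝ) | w.2 = y} := isClosed_eq continuous_snd continuous_const
    have c2 : IsClosed {w : (σ → ℝ) × β | w.1 = y} := isClosed_eq continuous_fst continuous_const
    obtain ⟨c, hc1, hc2⟩ := exists_between_compact (F '' (A ∩ {w | w.2 = y}))
      (G '' (B ∩ {w | w.1 = y})) ((hA.inter_right c1).image hF) ((hB.inter_right c2).image hG) (by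
        rintro _ ⟨⟨y1, z⟩, ⟨hz, rfl⟩, rfl⟩ _ ⟨⟨x, y2⟩, ⟨hx, hxy⟩, rfl⟩
        simp only [Set.mem_setOf_eq] at hxy
        subst hxy
        exact h _ _ _ hx hz)
    refine ⟨c, ?_⟩
    have k1 : IsClosed (Prod.snd '' (A ∩ {w | F w ≤ c})) :=
      ((hA.inter_right (isClosed_le hF continuous_const)).image continuous_snd).isClosed
    have k2 : IsClosed (Prod.fst '' (B ∩ {w | c ≤ G w})) :=
      ((hB.inter_right (isClosed_le continuous_const hG)).image continuous_fst).isClosed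
    have m1 : y ∈ (Prod.snd '' (A ∩ {w | F w ≤ c}))ᶜ := by
      rintro ⟨w, ⟨hw, hw'⟩, hwy⟩
      exact absurd (hc1 _ ⟨w, ⟨hw, hwy⟩, rfl⟩) (not_lt.2 hw')
    have m2 : y ∈ (Prod.fst '' (B ∩ {w | c ≤ G w}))ᶜ := by
      rintro ⟨w, ⟨hw, hw'⟩, hwy⟩
      exact absurd (hc2 _ ⟨w, ⟨hw, hwy⟩, rfl⟩) (not_lt.2 hw')
    filter_upwards [k1.isOpen_compl.mem_nhds m1, k2.isOpen_compl.mem_nhds m2] with y' h1 h2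
    refine ⟨fun w hw hwy => ?_, fun w hw hwy => ?_⟩
    · by_contra hcon
      exact h1 ⟨w, ⟨hw, not_lt.1 hcon⟩, hwy⟩
    · by_contra hcon
      exact h2 ⟨w, ⟨hw, not_lt.1 hcon⟩, hwy⟩)
  obtain ⟨δ₁, hδ₁, hd₁⟩ := hA.exists_forall_le' (f := fun w => F w - u w.2)
    (by fun_prop) (a := 0) (fun w hw => sub_pos.2 ((hu w.2).1 w hw rfl))
  obtain ⟨δ₂, hδ₂, hd₂⟩ := hB.exists_forall_le' (f := fun w => u w.1 - G w)
    (by fun_prop) (a := 0) (fun w hw => sub_pos.2 ((hu w.1).2 w hw rfl))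
  obtain ⟨q, hq⟩ := stone_weierstrass (Prod.snd '' A ∪ Prod.fst '' B)
    ((hA.image continuous_snd).union (hB.image continuous_fst)) u u.continuous (min δ₁ δ₂)
    (lt_min hδ₁ hδ₂)
  refine ⟨q, fun w hw => ?_, fun w hw => ?_⟩
  · have h1 := abs_lt.1 (hq w.2 (Or.inl ⟨w, hw, rfl⟩))
    have h2 := hd₁ w hw
    have h3 := min_le_left δ₁ δ₂
    linarith [h1.2]
  · have h1 := abs_lt.1 (hq w.1 (Or.inr ⟨w, hw, rfl⟩))
    have h2 := hd₂ w hw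
    have h3 := min_le_right δ₁ δ₂
    linarith [h1.1]

lemma schm_sum {k l a : ℕ} (g : Fin a → MvPolynomial (Fin k ⊕ Fin l) ℝ)
    (hK : IsCompact {w : (Fin k → ℝ) × (Fin l → ℝ) | ∀ j, 0 ≤ eval (Sum.elim w.1 w.2) (g j)})
    (p : MvPolynomial (Fin k ⊕ Fin l) ℝ)
    (hp : ∀ w : (Fin k → ℝ) × (Fin l → ℝ), (∀ j, 0 ≤ eval (Sum.elim w.1 w.2) (g j)) →
      0 < eval (Sum.elim w.1 w.2) p) : InPreordering g p := by
  have hel : ∀ x : Fin k ⊕ Fin l → ℝ, Sum.elim (x ∘ Sum.inl) (x ∘ Sum.inr) = x :=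
    fun x => Sum.elim_comp_inl_inr x
  have hcont : Continuous (fun w : (Fin k → ℝ) × (Fin l → ℝ) =>
      ∑ i, Sum.elim w.1 w.2 i * Sum.elim w.1 w.2 i) := by
    simp only [Fintype.sum_sum_type, Sum.elim_inl, Sum.elim_inr]
    fun_prop
  obtain ⟨M, hM⟩ := (hK.image hcont).bddAbove
  refine schmuedgen (inPre_pre g) g (inPre_gen g) (|M| + 1) (by positivity) ?_ p ?_
  · intro x hx
    have := hM ⟨(x ∘ Sum.inl, x ∘ Sum.inr), by simpa only [Set.mem_setOf_eq, hel] using hx, rfl⟩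
    simp only [hel] at this
    linarith [le_abs_self M]
  · intro x hx
    have := hp (x ∘ Sum.inl, x ∘ Sum.inr) (by simpa only [hel] using hx)
    simpa only [hel] using this

lemma continuous_eval_elim {k l : ℕ} (p : MvPolynomial (Fin k ⊕ Fin l) ℝ) :
    Continuous (fun w : (Fin k → ℝ) × (Fin l → ℝ) => eval (Sum.elim w.1 w.2) p) := by
  refine (MvPolynomial.continuous_eval p).comp ?_
  refine continuous_pi fun i => ?_
  cases i with
  | inl i => exact (continuous_apply i).comp continuous_fst
  | inr i => exact (continuous_apply i).comp continuous_snd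

end SparseSchm

theorem sup_of_representable_shifts_eq_min
    (n m p a b : ℕ)
    (g : Fin a → MvPolynomial (Fin n ⊕ Fin m) ℝ)
    (h : Fin b → MvPolynomial (Fin m ⊕ Fin p) ℝ)
    (Kxy : Set ((Fin n → ℝ) × (Fin m → ℝ)))
    (Kyz : Set ((Fin m → ℝ) × (Fin p → ℝ)))
    (K : Set ((Fin n → ℝ) × (Fin m → ℝ) × (Fin p → ℝ)))
    (hKxy : Kxy = {w | ∀ j, 0 ≤ eval (Sum.elim w.1 w.2) (g j)})
    (hKyz : Kyz = {w | ∀ k, 0 ≤ eval (Sum.elim w.1 w.2) (h k)})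
    (hK : K = {w | (w.1, w.2.1) ∈ Kxy ∧ w.2 ∈ Kyz})
    (hKxyCompact : IsCompact Kxy) (hKyzCompact : IsCompact Kyz)
    (hKne : K.Nonempty) (hKint : (interior K).Nonempty)
    (f : MvPolynomial (Fin n ⊕ Fin m ⊕ Fin p) ℝ)
    (f₁ : MvPolynomial (Fin n ⊕ Fin m) ℝ) (f₂ : MvPolynomial (Fin m ⊕ Fin p) ℝ)
    (hf : f = rename (Sum.map id Sum.inl) f₁ + rename Sum.inr f₂)
    (fstar : ℝ)
    (hfstarmem : ∃ w ∈ K, eval (Sum.elim w.1 (Sum.elim w.2.1 w.2.2)) f = fstar)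
    (hfstarmin : ∀ w ∈ K, fstar ≤ eval (Sum.elim w.1 (Sum.elim w.2.1 w.2.2)) f) :
    sSup {lam : ℝ | ∃ (σ : MvPolynomial (Fin n ⊕ Fin m) ℝ)
        (ψ : MvPolynomial (Fin m ⊕ Fin p) ℝ),
        InPreordering g σ ∧ InPreordering h ψ ∧
        f - C lam = rename (Sum.map id Sum.inl) σ + rename Sum.inr ψ} = fstar ∧
    (∀ ε : ℝ, 0 < ε → ∃ (σ : MvPolynomial (Fin n ⊕ Fin m) ℝ)
        (ψ : MvPolynomial (Fin m ⊕ Fin p) ℝ),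
        InPreordering g σ ∧ InPreordering h ψ ∧
        f - C fstar + C ε = rename (Sum.map id Sum.inl) σ + rename Sum.inr ψ) ∧
    (∀ lam : ℝ, (∃ (σ : MvPolynomial (Fin n ⊕ Fin m) ℝ)
        (ψ : MvPolynomial (Fin m ⊕ Fin p) ℝ),
        InPreordering g σ ∧ InPreordering h ψ ∧
        f - C lam = rename (Sum.map id Sum.inl) σ + rename Sum.inr ψ) → lam ≤ fstar) := by
  have hev : ∀ (u : Fin n → ℝ) (v : Fin m → ℝ) (w : Fin p → ℝ)
      (F₁ : MvPolynomial (Fin n ⊕ Fin m) ℝ) (F₂ : MvPolynomial (Fin m ⊕ Fin p) ℝ),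
      eval (Sum.elim u (Sum.elim v w)) (rename (Sum.map id Sum.inl) F₁ + rename Sum.inr F₂) =
      eval (Sum.elim u v) F₁ + eval (Sum.elim v w) F₂ := by
    intro u v w F₁ F₂
    rw [map_add, eval_rename, eval_rename]
    congr 3
    · ext i; cases i <;> rfl
  have hC : ∀ lam : ℝ, (∃ (σ : MvPolynomial (Fin n ⊕ Fin m) ℝ)
        (ψ : MvPolynomial (Fin m ⊕ Fin p) ℝ),
        InPreordering g σ ∧ InPreordering h ψ ∧
        f - C lam = rename (Sum.map id Sum.inl) σ + rename Sum.inr ψ) → lam ≤ fstar := by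
    rintro lam ⟨σ, ψ, hσ, hψ, heq⟩
    obtain ⟨⟨x, y, z⟩, hw, hwf⟩ := hfstarmem
    have h1 := congrArg (eval (Sum.elim x (Sum.elim y z))) heq
    rw [hev, map_sub, eval_C] at h1
    simp only at hwf
    rw [hwf] at h1
    rw [hK, hKxy, hKyz] at hw
    have h2 := SparseSchm.inPre_nonneg g hσ (Sum.elim x y) hw.1
    have h3 := SparseSchm.inPre_nonneg h hψ (Sum.elim y z) hw.2
    linarith
  have hB : ∀ ε : ℝ, 0 < ε → ∃ (σ : MvPolynomial (Fin n ⊕ Fin m) ℝ)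
        (ψ : MvPolynomial (Fin m ⊕ Fin p) ℝ),
        InPreordering g σ ∧ InPreordering h ψ ∧
        f - C fstar + C ε = rename (Sum.map id Sum.inl) σ + rename Sum.inr ψ := by
    intro ε hε
    obtain ⟨q, hq1, hq2⟩ := SparseSchm.split_poly Kxy Kyz hKxyCompact hKyzCompact
      (fun w => eval (Sum.elim w.1 w.2) (f₁ + C (ε - fstar)))
      (fun w => eval (Sum.elim w.1 w.2) (-f₂))
      (SparseSchm.continuous_eval_elim _) (SparseSchm.continuous_eval_elim _) (by
        intro x y z hx hz
        have := hfstarmin (x, y, z) (by rw [hK]; exact ⟨hx, hz⟩)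
        simp only at this
        rw [hf, hev] at this
        simp only [map_neg, map_add, eval_C]
        linarith)
    subst hKxy hKyz
    refine ⟨f₁ + C (ε - fstar) - rename Sum.inr q, f₂ + rename Sum.inl q,
      SparseSchm.schm_sum g hKxyCompact _ ?_, SparseSchm.schm_sum h hKyzCompact _ ?_, ?_⟩
    · intro w hw
      have := hq1 w hw
      rw [map_sub, eval_rename, Sum.elim_comp_inr]
      linarith
    · intro w hw
      have := hq2 w hw
      rw [map_add, eval_rename, Sum.elim_comp_inl]
      simp only [map_neg] at this
      linarith
    · rw [hf]
      simp only [map_add, map_sub, rename_C, rename_rename, C_sub]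
      have : (Sum.map id Sum.inl ∘ Sum.inr : Fin m → Fin n ⊕ Fin m ⊕ Fin p) =
        Sum.inr ∘ Sum.inl := rfl
      rw [this]
      ring
  refine ⟨?_, hB, hC⟩
  have hmem : ∀ ε : ℝ, 0 < ε → fstar - ε ∈ {lam : ℝ | ∃ (σ : MvPolynomial (Fin n ⊕ Fin m) ℝ)
        (ψ : MvPolynomial (Fin m ⊕ Fin p) ℝ),
        InPreordering g σ ∧ InPreordering h ψ ∧
        f - C lam = rename (Sum.map id Sum.inl) σ + rename Sum.inr ψ} := by
    intro ε hε
    obtain ⟨σ, ψ, h1, h2, h3⟩ := hB ε hε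
    refine ⟨σ, ψ, h1, h2, ?_⟩
    rw [← h3, C_sub]; ring
  refine csSup_eq_of_forall_le_of_forall_lt_exists_gt ⟨_, hmem 1 one_pos⟩ (fun lam hl => hC lam hl) ?_
  intro w hw
  exact ⟨fstar - (fstar - w) / 2, hmem _ (by linarith), by linarith⟩
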